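/- Under hypotheses (H2)-(H4), for any q ∈ ℝ^{d−1}×[0,∞), any z ∈ ℤ^{d−1}×ℕ*, and any sequences ε_n > 0 and z_n ∈ ℤ^{d−1}×ℕ* with lim_n ε_n = 0 and lim_n ε_n·z_n = q, one has lim_{n→∞} ε_n·log G₊(z, z_n) = −sup_{a∈D} a·q. -/

import Mathlib

open scoped ENNReal
open Filter MeasureTheory

namespace ReflectedRW

/-- `ℤ^d` realized as `ℤ^{d-1} × ℤ`. -/
abbrev Zd (d : ℕ) := (Fin (d-1) → ℤ) × ℤ
/-- `ℝ^d` realized as `ℝ^{d-1} × ℝ`. -/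
abbrev Rd (d : ℕ) := (Fin (d-1) → ℝ) × ℝ
/-- The state space `ℤ^{d-1} × ℕ` of the reflected walk. -/
abbrev St (d : ℕ) := (Fin (d-1) → ℤ) × ℕ

/-- Embedding of the state space into `ℤ^d`. -/
def toZ (d : ℕ) (z : St d) : Zd d := (z.1, (z.2 : ℤ))

/-- Embedding of `ℤ^d` into `ℝ^d`. -/
def toR (d : ℕ) (z : Zd d) : Rd d := (fun i => (z.1 i : ℝ), (z.2 : ℝ))

/-- Scalar product `a · z` of `a ∈ ℝ^d` and `z ∈ ℤ^d`. -/
noncomputable def dotZ (d : ℕ) (a : Rd d) (z : Zd d) : ℝ :=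
  (∑ i, a.1 i * (z.1 i : ℝ)) + a.2 * (z.2 : ℝ)

/-- Scalar product on `ℝ^d`. -/
noncomputable def dotR (d : ℕ) (a q : Rd d) : ℝ :=
  (∑ i, a.1 i * q.1 i) + a.2 * q.2

/-- One-step transition probabilities of the reflected random walk `Z(t)`:
jumps with law `μ` in the interior and with law `μ0` on the boundary `y = 0`. -/
noncomputable def step (d : ℕ) (μ μ0 : Zd d → ℝ) (z z' : St d) : ℝ≥0∞ :=
  if z.2 = 0 then ENNReal.ofReal (μ0 (toZ d z' - toZ d z))
  else ENNReal.ofReal (μ (toZ d z' - toZ d z))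

/-- Real-valued version of the transition kernel of `Z(t)`. -/
noncomputable def stepR (d : ℕ) (μ μ0 : Zd d → ℝ) (z z' : St d) : ℝ :=
  if z.2 = 0 then μ0 (toZ d z' - toZ d z) else μ (toZ d z' - toZ d z)

/-- `n`-step kernel obtained by iterating a sub-Markov kernel `p`. -/
noncomputable def kerIter {S : Type*} [DecidableEq S] (p : S → S → ℝ≥0∞) :
    ℕ → S → S → ℝ≥0∞
  | 0, z, z' => if z = z' then 1 else 0
  | n+1, z, z' => ∑' w : S, kerIter p n z w * p w z'

/-- `n`-step transition probabilities of `Z(t)`: `P_z(Z(n) = z')`. -/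
noncomputable def stepn (d : ℕ) (μ μ0 : Zd d → ℝ) : ℕ → St d → St d → ℝ≥0∞ :=
  kerIter (step d μ μ0)

/-- Green's function `G(z,z') = ∑_{t ≥ 0} P_z(Z(t) = z')` of the reflected walk. -/
noncomputable def green (d : ℕ) (μ μ0 : Zd d → ℝ) (z z' : St d) : ℝ≥0∞ :=
  ∑' n : ℕ, stepn d μ μ0 n z z'

/-- Kernel of the walk killed upon hitting the boundary hyperplane `y = 0`. -/
noncomputable def stepKilled (d : ℕ) (μ μ0 : Zd d → ℝ) (z z' : St d) : ℝ≥0∞ :=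
  if z'.2 = 0 then 0 else step d μ μ0 z z'

/-- `n`-step kernel of the killed walk: `P_z(Z(n) = z', τ > n)` where
`τ` is the first return time to the boundary hyperplane. -/
noncomputable def stepKilledn (d : ℕ) (μ μ0 : Zd d → ℝ) : ℕ → St d → St d → ℝ≥0∞ :=
  kerIter (stepKilled d μ μ0)

/-- Green's function `G₊(z,z')` of the killed walk. -/
noncomputable def greenPlus (d : ℕ) (μ μ0 : Zd d → ℝ) (z z' : St d) : ℝ≥0∞ :=
  ∑' n : ℕ, stepKilledn d μ μ0 n z z'

/-- One-step kernel of the homogeneous random walk `S(t)` on `ℤ^d`. -/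
noncomputable def stepS (d : ℕ) (μ : Zd d → ℝ) (z z' : Zd d) : ℝ≥0∞ :=
  ENNReal.ofReal (μ (z' - z))

/-- `n`-step kernel of the homogeneous random walk on `ℤ^d`. -/
noncomputable def stepSn (d : ℕ) (μ : Zd d → ℝ) : ℕ → Zd d → Zd d → ℝ≥0∞ :=
  kerIter (stepS d μ)

/-- Green's function `G_S` of the homogeneous random walk on `ℤ^d`. -/
noncomputable def greenS (d : ℕ) (μ : Zd d → ℝ) (z z' : Zd d) : ℝ≥0∞ :=
  ∑' n : ℕ, stepSn d μ n z z'

/-- `hitProb z w = P_z(τ < ∞, Z(τ) = w)`, the hitting distribution on the boundary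
hyperplane, `τ = inf{t ≥ 1 : Z(t) ∈ ℤ^{d-1}×{0}}`. -/
noncomputable def hitProb (d : ℕ) (μ μ0 : Zd d → ℝ) (z w : St d) : ℝ≥0∞ :=
  if w.2 = 0 then
    ∑' n : ℕ, ∑' v : St d, stepKilledn d μ μ0 n z v * step d μ μ0 v w
  else 0

/-- The jump generating function `φ(a) = ∑_z μ(z) e^{a·z}`. -/
noncomputable def jgf (d : ℕ) (μ : Zd d → ℝ) (a : Rd d) : ℝ :=
  ∑' z : Zd d, μ z * Real.exp (dotZ d a z)

/-- Partial derivative `∂φ/∂β` of the jump generating function in the last coordinate. -/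
noncomputable def jgfDβ (d : ℕ) (μ : Zd d → ℝ) (a : Rd d) : ℝ :=
  ∑' z : Zd d, μ z * (z.2 : ℝ) * Real.exp (dotZ d a z)

/-- Gradient `∇φ(a)` of the jump generating function. -/
noncomputable def jgfGrad (d : ℕ) (μ : Zd d → ℝ) (a : Rd d) : Rd d :=
  (fun i => ∑' z : Zd d, μ z * (z.1 i : ℝ) * Real.exp (dotZ d a z), jgfDβ d μ a)

/-- The set `D = {a : φ(a) ≤ 1}`. -/
def Dset (d : ℕ) (μ : Zd d → ℝ) : Set (Rd d) := {a | jgf d μ a ≤ 1}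

/-- `∂₊D`: points of the boundary of `D` where the last coordinate of `∇φ` is `≥ 0`. -/
def bdPlus (d : ℕ) (μ : Zd d → ℝ) : Set (Rd d) :=
  {a | jgf d μ a = 1 ∧ 0 ≤ jgfDβ d μ a}

/-- `∂₋D`: points of the boundary of `D` where the last coordinate of `∇φ` is `≤ 0`. -/
def bdMinus (d : ℕ) (μ : Zd d → ℝ) : Set (Rd d) :=
  {a | jgf d μ a = 1 ∧ jgfDβ d μ a ≤ 0}

/-- `∂₀D`: points of the boundary of `D` where the last coordinate of `∇φ` is `0`. -/
def bdZero (d : ℕ) (μ : Zd d → ℝ) : Set (Rd d) :=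
  {a | jgf d μ a = 1 ∧ jgfDβ d μ a = 0}

/-- `Θ = {α ∈ ℝ^{d-1} : inf_β max(φ(α,β), φ₀(α,β)) ≤ 1}`. -/
noncomputable def Theta (d : ℕ) (μ μ0 : Zd d → ℝ) : Set (Fin (d-1) → ℝ) :=
  {α | (⨅ β : ℝ, max (jgf d μ (α, β)) (jgf d μ0 (α, β))) ≤ 1}

/-- `D̂ = (Θ×ℝ) ∩ D`. -/
noncomputable def Dhat (d : ℕ) (μ μ0 : Zd d → ℝ) : Set (Rd d) :=
  {a | a.1 ∈ Theta d μ μ0 ∧ jgf d μ a ≤ 1}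

/-- Normal cone to a convex set `s ⊆ ℝ^d` at the point `a`. -/
noncomputable def normalCone (d : ℕ) (s : Set (Rd d)) (a : Rd d) : Set (Rd d) :=
  {q | ∀ b ∈ s, dotR d q (b - a) ≤ 0}

/-- The mean vector `m = ∑_z z μ(z)`. -/
noncomputable def meanVec (d : ℕ) (μ : Zd d → ℝ) : Rd d :=
  (fun i => ∑' z : Zd d, μ z * (z.1 i : ℝ), ∑' z : Zd d, μ z * (z.2 : ℝ))

/-- The harmonic functions `h_a` of (1-8), for `a ∈ D̂ ∩ ∂₊D` with associated
point `abar = ā ∈ ∂₋D` (same first `d-1` coordinates as `a`). -/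
noncomputable def hfun (d : ℕ) (μ μ0 : Zd d → ℝ) (a abar : Rd d) (z : St d) : ℝ :=
  if jgf d μ0 abar = 1 then Real.exp (dotZ d abar (toZ d z))
  else if a = abar then
    (z.2 : ℝ) * Real.exp (dotZ d a (toZ d z))
      + (jgfDβ d μ0 a / (1 - jgf d μ0 a)) * Real.exp (dotZ d a (toZ d z))
  else
    Real.exp (dotZ d a (toZ d z))
      - ((1 - jgf d μ0 a) / (1 - jgf d μ0 abar)) * Real.exp (dotZ d abar (toZ d z))

/-- `h : ℤ^{d-1}×ℕ → ℝ` is harmonic for the reflected walk. -/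
def IsHarmonic (d : ℕ) (μ μ0 : Zd d → ℝ) (h : St d → ℝ) : Prop :=
  ∀ z : St d, HasSum (fun z' => stepR d μ μ0 z z' * h z') (h z)

/-- Minimal nonnegative harmonic function. -/
def IsMinimalHarmonic (d : ℕ) (μ μ0 : Zd d → ℝ) (h : St d → ℝ) : Prop :=
  IsHarmonic d μ μ0 h ∧ (∀ z, 0 ≤ h z) ∧ h ≠ 0 ∧
    ∀ h' : St d → ℝ, IsHarmonic d μ μ0 h' → (∀ z, 0 ≤ h' z) → h' ≠ 0 →
      (∀ z, h' z ≤ h z) → ∃ c : ℝ, 0 < c ∧ h' = fun z => c * h z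

/- Hypotheses (H0)–(H4). -/

/-- `(H0)`: `μ(x,y) = 0` for `y < -1` and `μ₀(x,y) = 0` for `y < 0`. -/
def H0 (d : ℕ) (μ μ0 : Zd d → ℝ) : Prop :=
  (∀ z : Zd d, z.2 < -1 → μ z = 0) ∧ (∀ z : Zd d, z.2 < 0 → μ0 z = 0)

/-- `(H1)`: the reflected walk is irreducible on `ℤ^{d-1}×ℕ`. -/
def H1 (d : ℕ) (μ μ0 : Zd d → ℝ) : Prop :=
  ∀ z z' : St d, ∃ n : ℕ, 0 < stepn d μ μ0 n z z'

/-- `(H2)`: the homogeneous walk with step law `μ` is irreducible on `ℤ^d` and its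
last coordinate is an aperiodic random walk on `ℤ`. -/
def H2 (d : ℕ) (μ : Zd d → ℝ) : Prop :=
  (∀ z z' : Zd d, ∃ n : ℕ, 0 < stepSn d μ n z z') ∧
    AddSubgroup.closure {y : ℤ | ∃ x : Fin (d-1) → ℤ, μ (x, y) ≠ 0} = ⊤

/-- `(H3)`: `m ≠ 0` and `m/|m| + m₀/|m₀| ≠ 0`. -/
noncomputable def H3 (d : ℕ) (μ μ0 : Zd d → ℝ) : Prop :=
  meanVec d μ ≠ 0 ∧ meanVec d μ0 ≠ 0 ∧
    ‖meanVec d μ‖⁻¹ • meanVec d μ + ‖meanVec d μ0‖⁻¹ • meanVec d μ0 ≠ 0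

/-- `(H4)`: the jump generating functions are finite everywhere on `ℝ^d`. -/
def H4 (d : ℕ) (μ μ0 : Zd d → ℝ) : Prop :=
  ∀ a : Rd d, Summable (fun z : Zd d => μ z * Real.exp (dotZ d a z)) ∧
    Summable (fun z : Zd d => μ0 z * Real.exp (dotZ d a z))

/-- `μ` is a probability distribution on `ℤ^d`. -/
def IsProb (d : ℕ) (μ : Zd d → ℝ) : Prop :=
  (∀ z : Zd d, 0 ≤ μ z) ∧ HasSum μ 1

section Kernels

variable {S : Type*} [DecidableEq S]

lemma kerIter_mono {p p' : S → S → ℝ≥0∞} (h : ∀ x y, p x y ≤ p' x y) (n : ℕ) (x y : S) :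
    kerIter p n x y ≤ kerIter p' n x y := by
  induction n generalizing y with
  | zero => simp [kerIter]
  | succ n ih =>
    simp only [kerIter]
    exact ENNReal.tsum_le_tsum fun w => mul_le_mul' (ih w) (h w y)

lemma kerIter_mul_le (p : S → S → ℝ≥0∞) (m n : ℕ) (x y z : S) :
    kerIter p m x y * kerIter p n y z ≤ kerIter p (m + n) x z := by
  induction n generalizing z with
  | zero =>
    by_cases h : y = z
    · subst h; simp [kerIter]
    · simp [kerIter, h]
  | succ n ih =>
    rw [← Nat.add_assoc]
    simp only [kerIter]
    rw [← ENNReal.tsum_mul_left]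
    refine ENNReal.tsum_le_tsum fun w => ?_
    rw [← mul_assoc]
    exact mul_le_mul' (ih w) le_rfl

lemma kerIter_one (p : S → S → ℝ≥0∞) (x y : S) : kerIter p 1 x y = p x y := by
  simp only [kerIter]
  rw [tsum_eq_single x]
  · simp
  · intro w hw
    simp [hw.symm]

lemma kerIter_equiv (e : S ≃ S) (p : S → S → ℝ≥0∞) (n : ℕ) (x y : S) :
    kerIter p n (e x) (e y) = kerIter (fun x y => p (e x) (e y)) n x y := by
  induction n generalizing y with
  | zero => simp [kerIter]
  | succ n ih =>
    simp only [kerIter]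
    rw [← e.tsum_eq]
    exact tsum_congr fun w => by rw [ih]

lemma _root_.ENNReal.tsum_iSup_of_monotone {α : Type*} {f : ℕ → α → ℝ≥0∞} (hf : Monotone f) :
    ∑' a, ⨆ j, f j a = ⨆ j, ∑' a, f j a := by
  let _ : MeasurableSpace α := ⊤
  have : MeasurableSingletonClass α := ⟨fun _ => trivial⟩
  simp only [← lintegral_count]
  exact lintegral_iSup (fun n => measurable_from_top) hf

lemma kerIter_iSup {p : ℕ → S → S → ℝ≥0∞} (hp : Monotone p) (n : ℕ) (x y : S) :
    kerIter (fun x y => ⨆ j, p j x y) n x y = ⨆ j, kerIter (p j) n x y := by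
  induction n generalizing y with
  | zero => simp [kerIter]
  | succ n ih =>
    have hmono : ∀ w, Monotone fun j => kerIter (p j) n x w := fun w i j hij =>
      kerIter_mono (fun x y => hp hij x y) n x w
    simp only [kerIter]
    rw [← ENNReal.tsum_iSup_of_monotone]
    · refine tsum_congr fun w => ?_
      rw [ih]
      refine le_antisymm ?_ (iSup_le fun j => mul_le_mul' (le_iSup (fun j => kerIter (p j) n x w) j)
        (le_iSup (fun j => p j w y) j))
      rw [ENNReal.iSup_mul]
      refine iSup_le fun i => ?_
      rw [ENNReal.mul_iSup]
      exact iSup_le fun j => le_iSup_of_le (max i j)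
        (mul_le_mul' (hmono w (le_max_left i j)) (hp (le_max_right i j) w y))
    · intro i j hij w
      exact mul_le_mul' (hmono w hij) (hp hij w y)

/-- The largest of the `n`-step kernels obtained from `p`. -/
noncomputable def maxKer (p : S → S → ℝ≥0∞) (x y : S) : ℝ≥0∞ := ⨆ n, kerIter p n x y

lemma le_maxKer (p : S → S → ℝ≥0∞) (n : ℕ) (x y : S) : kerIter p n x y ≤ maxKer p x y :=
  le_iSup (fun n => kerIter p n x y) n

lemma maxKer_mono {p p' : S → S → ℝ≥0∞} (h : ∀ x y, p x y ≤ p' x y) (x y : S) :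
    maxKer p x y ≤ maxKer p' x y :=
  iSup_mono fun n => kerIter_mono h n x y

lemma one_le_maxKer_self (p : S → S → ℝ≥0∞) (x : S) : 1 ≤ maxKer p x x := by
  simpa [kerIter] using le_maxKer p 0 x x

lemma maxKer_mul_le (p : S → S → ℝ≥0∞) (x y z : S) :
    maxKer p x y * maxKer p y z ≤ maxKer p x z := by
  unfold maxKer
  rw [ENNReal.iSup_mul]
  refine iSup_le fun m => ?_
  rw [ENNReal.mul_iSup]
  exact iSup_le fun n => (kerIter_mul_le p m n x y z).trans (le_maxKer p (m + n) x z)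

lemma maxKer_le_tsum (p : S → S → ℝ≥0∞) (x y : S) : maxKer p x y ≤ ∑' n, kerIter p n x y :=
  iSup_le fun n => ENNReal.le_tsum n

lemma maxKer_pos_iff (p : S → S → ℝ≥0∞) (x y : S) :
    0 < maxKer p x y ↔ ∃ n, 0 < kerIter p n x y := lt_iSup_iff

lemma maxKer_pos_trans {p : S → S → ℝ≥0∞} {x y z : S} (h : 0 < maxKer p x y)
    (h' : 0 < maxKer p y z) : 0 < maxKer p x z :=
  lt_of_lt_of_le (ENNReal.mul_pos h.ne' h'.ne') (maxKer_mul_le p x y z)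

end Kernels

section Convolution

variable {G : Type*} [AddCommGroup G] [DecidableEq G]

lemma tsum_kerIter_mul (ν : G → ℝ≥0∞) (E : G → ℝ≥0∞) (hE : ∀ x y, E (x + y) = E x * E y)
    (n : ℕ) (x : G) :
    ∑' y, kerIter (fun x y => ν (y - x)) n x y * E y = (∑' u, ν u * E u) ^ n * E x := by
  induction n with
  | zero =>
    rw [tsum_eq_single x]
    · simp [kerIter]
    · intro y hy
      simp [kerIter, hy.symm]
  | succ n ih =>
    simp only [kerIter, ← ENNReal.tsum_mul_right]
    rw [ENNReal.tsum_comm]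
    have h : ∀ w, ∑' y, kerIter (fun x y => ν (y - x)) n x w * ν (y - w) * E y
        = kerIter (fun x y => ν (y - x)) n x w * E w * ∑' u, ν u * E u := by
      intro w
      rw [← ENNReal.tsum_mul_left, ← (Equiv.addLeft w).tsum_eq]
      refine tsum_congr fun u => ?_
      simp only [Equiv.coe_addLeft, add_sub_cancel_left, hE]
      ring
    simp only [h]
    rw [ENNReal.tsum_mul_right, ih]
    ring

lemma mem_closure_of_kerIter_pos (ν : G → ℝ≥0∞) (n : ℕ) (x y : G)
    (h : 0 < kerIter (fun x y => ν (y - x)) n x y) :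
    y - x ∈ AddSubmonoid.closure {u | ν u ≠ 0} := by
  induction n generalizing y with
  | zero =>
    have : x = y := by
      by_contra hne
      simp [kerIter, hne] at h
    simp [this]
  | succ n ih =>
    simp only [kerIter] at h
    obtain ⟨w, hw⟩ : ∃ w, kerIter (fun x y => ν (y - x)) n x w * ν (y - w) ≠ 0 := by
      by_contra! hall
      simp [hall] at h
    rw [mul_ne_zero_iff] at hw
    have h1 := ih w (pos_iff_ne_zero.2 hw.1)
    have h2 : y - w ∈ AddSubmonoid.closure {u | ν u ≠ 0} :=
      AddSubmonoid.subset_closure hw.2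
    simpa using add_mem h2 h1

end Convolution

section HalfSpace

variable {d : ℕ}

/-- Kernel on `ℤ^d` of the walk with step weights `ν`, killed outside `{y > 0}`. -/
noncomputable def halfKer (ν : Zd d → ℝ≥0∞) (x y : Zd d) : ℝ≥0∞ :=
  if 0 < y.2 then ν (y - x) else 0

lemma halfKer_le (ν : Zd d → ℝ≥0∞) (x y : Zd d) : halfKer ν x y ≤ ν (y - x) := by
  unfold halfKer
  split_ifs <;> simp

lemma maxKer_halfKer_le_add (ν : Zd d → ℝ≥0∞) (x y v : Zd d) (hv : 0 ≤ v.2) :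
    maxKer (halfKer ν) x y ≤ maxKer (halfKer ν) (x + v) (y + v) := by
  refine iSup_mono fun n => ?_
  have h := kerIter_equiv (Equiv.addRight v) (halfKer ν) n x y
  simp only [Equiv.coe_addRight] at h
  rw [h]
  refine kerIter_mono (fun x y => ?_) n x y
  unfold halfKer
  split_ifs with h1 h2
  · simp
  · simp only [Prod.snd_add] at h2
    omega
  · simp
  · simp

lemma maxKer_sub_eq (ν : Zd d → ℝ≥0∞) (x y : Zd d) :
    maxKer (fun x y => ν (y - x)) x y = maxKer (fun x y => ν (y - x)) 0 (y - x) := by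
  unfold maxKer
  congr 1
  ext n
  have h := kerIter_equiv (Equiv.addRight x) (fun x y => ν (y - x)) n 0 (y - x)
  simpa using h

lemma kerIter_eq_iSup_halfKer (ν : Zd d → ℝ≥0∞) (n : ℕ) (w : Zd d) :
    kerIter (fun x y => ν (y - x)) n 0 w
      = ⨆ j : ℕ, kerIter (halfKer ν) n ((0, (j : ℤ)) : Zd d) (w + (0, (j : ℤ))) := by
  have hsup : (fun x y : Zd d => ν (y - x))
      = fun x y => ⨆ j : ℕ, halfKer ν (x + (0, (j : ℤ))) (y + (0, (j : ℤ))) := by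
    ext x y
    refine le_antisymm ?_ (iSup_le fun j => (halfKer_le ν _ _).trans (by simp))
    refine le_iSup_of_le ((-y.2).toNat + 1) ?_
    unfold halfKer
    rw [if_pos]
    · simp
    · simp only [Prod.snd_add]
      omega
  rw [hsup, kerIter_iSup (p := fun j x y => halfKer ν (x + (0, (j : ℤ))) (y + (0, (j : ℤ))))]
  · congr 1
    ext j
    have h := kerIter_equiv (Equiv.addRight ((0, (j : ℤ)) : Zd d)) (halfKer ν) n 0 w
    simp only [Equiv.coe_addRight, zero_add] at h
    exact h.symm
  · intro i j hij x y
    simp only [halfKer]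
    split_ifs with h1 h2
    · simp
    · simp only [Prod.snd_add] at h1 h2
      omega
    · simp
    · simp

lemma exists_lt_maxKer_halfKer (ν : Zd d → ℝ≥0∞) (w : Zd d) (c : ℝ≥0∞)
    (hc : c < maxKer (fun x y => ν (y - x)) 0 w) :
    ∃ j : ℕ, c < maxKer (halfKer ν) ((0, (j : ℤ)) : Zd d) (w + (0, (j : ℤ))) := by
  obtain ⟨n, hn⟩ := lt_iSup_iff.1 hc
  rw [kerIter_eq_iSup_halfKer] at hn
  obtain ⟨j, hj⟩ := lt_iSup_iff.1 hn
  exact ⟨j, hj.trans_le (le_maxKer _ _ _ _)⟩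

lemma maxKer_halfKer_pos_of_mem {ν : Zd d → ℝ≥0∞} {u x : Zd d} (hu : ν u ≠ 0)
    (hx : 0 < (x + u).2) : 0 < maxKer (halfKer ν) x (x + u) := by
  rw [maxKer_pos_iff]
  refine ⟨1, ?_⟩
  rw [kerIter_one, halfKer, if_pos hx]
  simpa [pos_iff_ne_zero] using hu

lemma maxKer_halfKer_pos_of_up {ν : Zd d → ℝ≥0∞} {u : Zd d}
    (hu : u ∈ AddSubmonoid.closure {u | ν u ≠ 0 ∧ 0 ≤ u.2}) :
    0 ≤ u.2 ∧ ∀ x : Zd d, 0 < x.2 → 0 < maxKer (halfKer ν) x (x + u) := by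
  induction hu using AddSubmonoid.closure_induction with
  | mem u hu =>
    refine ⟨hu.2, fun x hx => maxKer_halfKer_pos_of_mem hu.1 ?_⟩
    have := hu.2
    simp only [Prod.snd_add]
    omega
  | zero =>
    refine ⟨le_rfl, fun x _ => ?_⟩
    rw [add_zero]
    exact zero_lt_one.trans_le (one_le_maxKer_self _ x)
  | add u v _ _ hu hv =>
    refine ⟨add_nonneg hu.1 hv.1, fun x hx => ?_⟩
    rw [← add_assoc]
    exact maxKer_pos_trans (hu.2 x hx) (hv.2 _ (add_pos_of_pos_of_nonneg hx hu.1))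

lemma maxKer_halfKer_pos_of_down {ν : Zd d → ℝ≥0∞} {u : Zd d}
    (hu : u ∈ AddSubmonoid.closure {u | ν u ≠ 0 ∧ u.2 ≤ 0}) :
    u.2 ≤ 0 ∧ ∀ x : Zd d, 0 < (x + u).2 → 0 < maxKer (halfKer ν) x (x + u) := by
  induction hu using AddSubmonoid.closure_induction with
  | mem u hu => exact ⟨hu.2, fun x hx => maxKer_halfKer_pos_of_mem hu.1 hx⟩
  | zero =>
    refine ⟨le_rfl, fun x _ => ?_⟩
    rw [add_zero]
    exact zero_lt_one.trans_le (one_le_maxKer_self _ x)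
  | add u v _ _ hu hv =>
    refine ⟨add_nonpos hu.1 hv.1, fun x hx => ?_⟩
    rw [← add_assoc] at hx ⊢
    refine maxKer_pos_trans (hu.2 x ?_) (hv.2 _ hx)
    have := hv.1
    simp only [Prod.snd_add] at hx ⊢
    omega

/-- The killed walk is irreducible on the open half-space: perform the upward steps first. -/
lemma maxKer_halfKer_pos {ν : Zd d → ℝ≥0∞} (h : AddSubmonoid.closure {u | ν u ≠ 0} = ⊤)
    {x y : Zd d} (hx : 0 < x.2) (hy : 0 < y.2) : 0 < maxKer (halfKer ν) x y := by
  have hmem : y - x ∈ AddSubmonoid.closure {u | ν u ≠ 0} := h ▸ AddSubmonoid.mem_top _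
  have hsplit : {u : Zd d | ν u ≠ 0} = {u | ν u ≠ 0 ∧ 0 ≤ u.2} ∪ {u | ν u ≠ 0 ∧ u.2 ≤ 0} := by
    ext u
    have := le_total 0 u.2
    simp only [Set.mem_ofPred_eq, Set.mem_union]
    tauto
  rw [hsplit, AddSubmonoid.closure_union, AddSubmonoid.mem_sup] at hmem
  obtain ⟨u, hu, v, hv, huv⟩ := hmem
  have hy' : y = x + u + v := by rw [add_assoc, huv]; abel
  rw [hy'] at hy ⊢
  exact maxKer_pos_trans ((maxKer_halfKer_pos_of_up hu).2 x hx)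
    ((maxKer_halfKer_pos_of_down hv).2 _ hy)

lemma stepKilledn_eq_kerIter (μ μ0 : Zd d → ℝ) (n : ℕ) (z z' : St d) (hz : z.2 ≠ 0) :
    stepKilledn d μ μ0 n z z'
      = kerIter (halfKer fun u => ENNReal.ofReal (μ u)) n (toZ d z) (toZ d z') := by
  have hinj : Function.Injective (toZ d) := by
    rintro ⟨a, b⟩ ⟨a', b'⟩ h
    simp only [toZ, Prod.mk.injEq, Nat.cast_inj] at h
    exact Prod.ext h.1 h.2
  have hpos : ∀ n (w : Zd d), w.2 ≤ 0 →
      kerIter (halfKer fun u => ENNReal.ofReal (μ u)) n (toZ d z) w = 0 := by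
    intro n w hw
    cases n with
    | zero =>
      have : toZ d z ≠ w := by
        rintro rfl
        simp only [toZ] at hw
        omega
      simp [kerIter, this]
    | succ n => simp [kerIter, halfKer, not_lt.2 hw]
  unfold stepKilledn
  induction n generalizing z' with
  | zero => simp [kerIter, hinj.eq_iff]
  | succ n ih =>
    simp only [kerIter]
    rw [← hinj.tsum_eq]
    · refine tsum_congr fun w => ?_
      rw [ih]
      by_cases hw : w.2 = 0
      · rw [hpos n (toZ d w) (by simp [toZ, hw])]
        simp
      · congr 1
        by_cases hz' : z'.2 = 0
        · simp [stepKilled, halfKer, toZ, hz']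
        · have hz'' : 0 < (toZ d z').2 := by
            simp only [toZ]
            omega
          simp only [stepKilled, step, halfKer, if_neg hw, if_neg hz', if_pos hz'']
    · intro w hw
      by_contra hrange
      apply hw
      have hw0 : w.2 ≤ 0 := by
        by_contra! hpos'
        exact hrange ⟨(w.1, w.2.toNat), by simp [toZ, hpos'.le]⟩
      simp [hpos n w hw0]

end HalfSpace

section Costs

variable {d : ℕ}

lemma nsmul_le_of_subadditive {G : Type*} [AddMonoid G] {f : G → ℝ} (h0 : f 0 ≤ 0)
    (hadd : ∀ u v, f (u + v) ≤ f u + f v) (n : ℕ) (u : G) : f (n • u) ≤ n * f u := by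
  induction n with
  | zero => simpa using h0
  | succ n ih =>
    rw [succ_nsmul]
    push_cast
    linarith [hadd (n • u) u]

lemma exists_le_mul_norm_of_subadditive {ι : Type*} [Fintype ι] [DecidableEq ι]
    {f : (ι → ℤ) → ℝ} (h0 : f 0 ≤ 0) (hadd : ∀ u v, f (u + v) ≤ f u + f v) :
    ∃ K : ℝ, 0 ≤ K ∧ ∀ u : ι → ℤ, f u ≤ K * ‖fun i => (u i : ℝ)‖ := by
  refine ⟨∑ i, (|f (Pi.single i 1)| + |f (Pi.single i (-1))|), by positivity, fun u => ?_⟩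
  have hsingle : ∀ i (n : ℤ), f (Pi.single i n)
      ≤ (|f (Pi.single i 1)| + |f (Pi.single i (-1))|) * |(n : ℝ)| := by
    intro i n
    have hp := le_abs_self (f (Pi.single i 1))
    have hm := le_abs_self (f (Pi.single i (-1)))
    have hp0 := abs_nonneg (f (Pi.single i 1))
    have hm0 := abs_nonneg (f (Pi.single i (-1)))
    obtain ⟨k, rfl | rfl⟩ := n.eq_nat_or_neg
    · have h := nsmul_le_of_subadditive h0 hadd k (Pi.single i 1)
      rw [← Pi.single_smul, nsmul_eq_mul, mul_one] at h
      have hk : (0 : ℝ) ≤ k := k.cast_nonneg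
      rw [Int.cast_natCast, abs_of_nonneg hk]
      nlinarith
    · have h := nsmul_le_of_subadditive h0 hadd k (Pi.single i (-1))
      rw [← Pi.single_smul, nsmul_eq_mul, mul_neg_one] at h
      have hk : (0 : ℝ) ≤ k := k.cast_nonneg
      rw [Int.cast_neg, abs_neg, Int.cast_natCast, abs_of_nonneg hk]
      nlinarith
  calc f u = f (∑ i, Pi.single i (u i)) := by rw [Finset.univ_sum_single]
    _ ≤ ∑ i, f (Pi.single i (u i)) :=
        Finset.le_sum_of_subadditive f h0 hadd _ _
    _ ≤ ∑ i, (|f (Pi.single i 1)| + |f (Pi.single i (-1))|) * ‖fun i => (u i : ℝ)‖ := by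
        refine Finset.sum_le_sum fun i _ => (hsingle i (u i)).trans ?_
        refine mul_le_mul_of_nonneg_left ?_ (by positivity)
        exact norm_le_pi_norm (fun i => (u i : ℝ)) i
    _ = _ := by rw [Finset.sum_mul]

lemma toR_add (x y : Zd d) : toR d (x + y) = toR d x + toR d y := by
  ext <;> simp [toR]

lemma toR_sub (x y : Zd d) : toR d (x - y) = toR d x - toR d y := by
  ext <;> simp [toR]

lemma toR_nsmul (k : ℕ) (x : Zd d) : toR d (k • x) = (k : ℝ) • toR d x := by
  ext <;> simp [toR]

lemma toR_zero : toR d 0 = 0 := by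
  ext <;> simp [toR]

lemma kerIter_le_one {ν : Zd d → ℝ≥0∞} (hν : ∑' u, ν u = 1) (n : ℕ) (x y : Zd d) :
    kerIter (fun x y => ν (y - x)) n x y ≤ 1 := by
  have h := tsum_kerIter_mul ν (fun _ => 1) (by simp) n x
  simp only [mul_one, hν, one_pow] at h
  exact h ▸ ENNReal.le_tsum y

lemma maxKer_le_one {ν : Zd d → ℝ≥0∞} (hν : ∑' u, ν u = 1) (x y : Zd d) :
    maxKer (fun x y => ν (y - x)) x y ≤ 1 :=
  iSup_le fun n => kerIter_le_one hν n x y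

lemma maxKer_halfKer_le_one {ν : Zd d → ℝ≥0∞} (hν : ∑' u, ν u = 1) (x y : Zd d) :
    maxKer (halfKer ν) x y ≤ 1 :=
  (maxKer_mono (halfKer_le ν) x y).trans (maxKer_le_one hν x y)

/-- Cost of a displacement by `w` for the free walk. -/
noncomputable def freeCost (ν : Zd d → ℝ≥0∞) (w : Zd d) : ℝ :=
  -Real.log (maxKer (fun x y => ν (y - x)) 0 w).toReal

/-- Cost of the transition from `x` to `y` for the walk killed outside `{y > 0}`. -/
noncomputable def halfCost (ν : Zd d → ℝ≥0∞) (x y : Zd d) : ℝ :=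
  -Real.log (maxKer (halfKer ν) x y).toReal

lemma neg_log_toReal_le {a b : ℝ≥0∞} (ha : 0 < a) (hab : a ≤ b) (hb : b ≤ 1) :
    -Real.log b.toReal ≤ -Real.log a.toReal := by
  have hb' : b ≠ ⊤ := (hb.trans_lt ENNReal.one_lt_top).ne
  have ha' : a ≠ ⊤ := (hab.trans_lt hb'.lt_top).ne
  exact neg_le_neg (Real.log_le_log (ENNReal.toReal_pos ha.ne' ha') (ENNReal.toReal_mono hb' hab))

lemma neg_log_toReal_le_add {a b c : ℝ≥0∞} (ha : 0 < a) (hb : 0 < b) (hab : a * b ≤ c)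
    (hc : c ≤ 1) (ha1 : a ≤ 1) (hb1 : b ≤ 1) :
    -Real.log c.toReal ≤ -Real.log a.toReal + -Real.log b.toReal := by
  have h := neg_log_toReal_le (ENNReal.mul_pos ha.ne' hb.ne') hab hc
  have ha' := ENNReal.toReal_pos ha.ne' (ha1.trans_lt ENNReal.one_lt_top).ne
  have hb' := ENNReal.toReal_pos hb.ne' (hb1.trans_lt ENNReal.one_lt_top).ne
  rw [ENNReal.toReal_mul, Real.log_mul ha'.ne' hb'.ne'] at h
  linarith

section

variable {ν : Zd d → ℝ≥0∞} (hν : ∑' u, ν u = 1)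
  (hirr : AddSubmonoid.closure {u | ν u ≠ 0} = ⊤)

include hν in
lemma freeCost_nonneg (w : Zd d) : 0 ≤ freeCost ν w := by
  have h := ENNReal.toReal_mono ENNReal.one_ne_top (maxKer_le_one hν 0 w)
  exact neg_nonneg.2 (Real.log_nonpos ENNReal.toReal_nonneg h)

include hν in
lemma freeCost_zero : freeCost ν 0 = 0 := by
  have h : maxKer (fun x y => ν (y - x)) 0 (0 : Zd d) = 1 :=
    le_antisymm (maxKer_le_one hν 0 0) (one_le_maxKer_self _ 0)
  simp [freeCost, h]

include hirr in
lemma maxKer_free_pos (w : Zd d) : 0 < maxKer (fun x y => ν (y - x)) 0 w := by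
  set s : Zd d := (0, 1 + |w.2|) with hs
  have h : 0 < maxKer (halfKer ν) s (w + s) := by
    refine maxKer_halfKer_pos hirr ?_ ?_
    · simp only [hs]
      positivity
    · simp only [hs, Prod.snd_add]
      linarith [neg_abs_le w.2]
  have h' := h.trans_le (maxKer_mono (halfKer_le ν) s (w + s))
  rw [maxKer_sub_eq] at h'
  simpa using h'

include hν hirr in
lemma freeCost_add_le (u v : Zd d) : freeCost ν (u + v) ≤ freeCost ν u + freeCost ν v := by
  refine neg_log_toReal_le_add (maxKer_free_pos hirr u) (maxKer_free_pos hirr v) ?_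
    (maxKer_le_one hν _ _) (maxKer_le_one hν _ _) (maxKer_le_one hν _ _)
  have h := maxKer_mul_le (fun x y => ν (y - x)) 0 u (u + v)
  rwa [maxKer_sub_eq ν u (u + v), add_sub_cancel_left] at h

include hν hirr in
lemma halfCost_triangle {x y z : Zd d} (hx : 0 < x.2) (hy : 0 < y.2) (hz : 0 < z.2) :
    halfCost ν x z ≤ halfCost ν x y + halfCost ν y z :=
  neg_log_toReal_le_add (maxKer_halfKer_pos hirr hx hy) (maxKer_halfKer_pos hirr hy hz)
    (maxKer_mul_le _ x y z) (maxKer_halfKer_le_one hν _ _) (maxKer_halfKer_le_one hν _ _)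
    (maxKer_halfKer_le_one hν _ _)

include hν in
lemma halfCost_self (x : Zd d) : halfCost ν x x = 0 := by
  have h : maxKer (halfKer ν) x x = 1 :=
    le_antisymm (maxKer_halfKer_le_one hν x x) (one_le_maxKer_self _ x)
  simp [halfCost, h]

include hν hirr in
lemma halfCost_add_le {x y : Zd d} (hx : 0 < x.2) (hy : 0 < y.2) (v : Zd d) (hv : 0 ≤ v.2) :
    halfCost ν (x + v) (y + v) ≤ halfCost ν x y :=
  neg_log_toReal_le (maxKer_halfKer_pos hirr hx hy) (maxKer_halfKer_le_add ν x y v hv)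
    (maxKer_halfKer_le_one hν _ _)

include hν hirr in
lemma freeCost_le_halfCost {x y : Zd d} (hx : 0 < x.2) (hy : 0 < y.2) :
    freeCost ν (y - x) ≤ halfCost ν x y := by
  refine neg_log_toReal_le (maxKer_halfKer_pos hirr hx hy) ?_ (maxKer_le_one hν _ _)
  rw [← maxKer_sub_eq]
  exact maxKer_mono (halfKer_le ν) x y

include hν hirr in
lemma exists_halfCost_horizontal_le : ∃ K : ℝ, 0 ≤ K ∧ ∀ x y : Zd d, 0 < x.2 → x.2 = y.2 →
    halfCost ν x y ≤ K * ‖toR d (y - x)‖ := by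
  obtain ⟨K, hK, h⟩ := exists_le_mul_norm_of_subadditive
    (f := fun u : Fin (d - 1) → ℤ => halfCost ν ((0, 1) : Zd d) (u, 1))
    (halfCost_self hν _).le (fun u v => by
      have h1 := halfCost_triangle hν hirr (x := (0, 1)) (y := (u, 1)) (z := (u + v, 1))
        one_pos one_pos one_pos
      have h2 := halfCost_add_le hν hirr (x := (0, 1)) (y := (v, 1)) one_pos one_pos (u, 0) le_rfl
      simp only [Prod.mk_add_mk, zero_add, add_zero, add_comm v u] at h2
      linarith)
  refine ⟨K, hK, fun x y hx hxy => ?_⟩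
  have h1 := halfCost_add_le hν hirr (x := (0, 1)) (y := (y.1 - x.1, 1)) one_pos one_pos
    (x.1, x.2 - 1) (by simp only; omega)
  simp only [Prod.mk_add_mk, zero_add, sub_add_cancel, add_sub_cancel] at h1
  have h2 : ((y.1, x.2) : Zd d) = y := by rw [hxy]
  rw [h2] at h1
  refine h1.trans ((h _).trans (mul_le_mul_of_nonneg_left ?_ hK))
  exact norm_fst_le (toR d (y - x))

include hν hirr in
lemma exists_halfCost_vertical_le : ∃ K : ℝ, 0 ≤ K ∧ ∀ x y : Zd d, 0 < x.2 → 0 < y.2 →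
    x.1 = y.1 → halfCost ν x y ≤ K * ‖toR d (y - x)‖ := by
  set A := halfCost ν ((0, 1) : Zd d) (0, 2)
  set B := halfCost ν ((0, 2) : Zd d) (0, 1)
  have hup1 : ∀ x : Zd d, 0 < x.2 → halfCost ν x (x + (0, 1)) ≤ A := by
    intro x hx
    have h := halfCost_add_le hν hirr (x := (0, 1)) (y := (0, 2)) one_pos two_pos
      (x.1, x.2 - 1) (by simp only; omega)
    convert h using 2 <;> ext <;> simp; omega
  have hdown1 : ∀ x : Zd d, 0 < x.2 → halfCost ν (x + (0, 1)) x ≤ B := by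
    intro x hx
    have h := halfCost_add_le hν hirr (x := (0, 2)) (y := (0, 1)) two_pos one_pos
      (x.1, x.2 - 1) (by simp only; omega)
    convert h using 2 <;> ext <;> simp; omega
  have hup : ∀ (k : ℕ) (x : Zd d), 0 < x.2 → halfCost ν x (x + (0, (k : ℤ))) ≤ k * A := by
    intro k x hx
    induction k with
    | zero =>
      have h0 : x + ((0, ((0 : ℕ) : ℤ)) : Zd d) = x := by ext <;> simp
      rw [h0]
      simpa using (halfCost_self hν x).le
    | succ k ih =>
      have hpos : 0 < (x + (0, (k : ℤ))).2 := by simp only [Prod.snd_add]; omega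
      have h1 := hup1 _ hpos
      have h2 := halfCost_triangle hν hirr hx hpos (z := x + (0, (k : ℤ)) + (0, 1))
        (by simp only [Prod.snd_add] at hpos ⊢; omega)
      have h3 : x + (0, ((k + 1 : ℕ) : ℤ)) = x + (0, (k : ℤ)) + (0, 1) := by
        rw [add_assoc]; simp
      rw [h3]
      push_cast
      linarith
  have hdown : ∀ (k : ℕ) (x : Zd d), 0 < x.2 → halfCost ν (x + (0, (k : ℤ))) x ≤ k * B := by
    intro k x hx
    induction k with
    | zero =>
      have h0 : x + ((0, ((0 : ℕ) : ℤ)) : Zd d) = x := by ext <;> simp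
      rw [h0]
      simpa using (halfCost_self hν x).le
    | succ k ih =>
      have hpos : 0 < (x + (0, (k : ℤ))).2 := by simp only [Prod.snd_add]; omega
      have h1 := hdown1 _ hpos
      have h2 := halfCost_triangle hν hirr (x := x + (0, (k : ℤ)) + (0, 1))
        (by simp only [Prod.snd_add] at hpos ⊢; omega) hpos hx
      have h3 : x + (0, ((k + 1 : ℕ) : ℤ)) = x + (0, (k : ℤ)) + (0, 1) := by
        rw [add_assoc]; simp
      rw [h3]
      push_cast
      linarith
  refine ⟨|A| + |B|, by positivity, fun x y hx hy hxy => ?_⟩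
  have hA := le_abs_self A
  have hB := le_abs_self B
  have hA0 := abs_nonneg A
  have hB0 := abs_nonneg B
  have hn : |((y.2 - x.2 : ℤ) : ℝ)| ≤ ‖toR d (y - x)‖ := norm_snd_le (toR d (y - x))
  refine le_trans ?_ (mul_le_mul_of_nonneg_left hn (by positivity))
  obtain ⟨k, hk | hk⟩ := (y.2 - x.2).eq_nat_or_neg
  · have h := hup k x hx
    have h3 : x + (0, (k : ℤ)) = y := by rw [← hk]; ext <;> simp [hxy]
    have hk0 : (0 : ℝ) ≤ k := k.cast_nonneg
    rw [h3] at h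
    rw [hk, Int.cast_natCast, abs_of_nonneg hk0]
    nlinarith
  · have h := hdown k y hy
    have h3 : y + (0, (k : ℤ)) = x := by
      have : (k : ℤ) = x.2 - y.2 := by omega
      rw [this]; ext <;> simp [hxy]
    have hk0 : (0 : ℝ) ≤ k := k.cast_nonneg
    rw [h3] at h
    rw [hk, Int.cast_neg, abs_neg, Int.cast_natCast, abs_of_nonneg hk0]
    nlinarith

include hν hirr in
lemma exists_halfCost_le : ∃ K : ℝ, 0 ≤ K ∧ ∀ x y : Zd d, 0 < x.2 → 0 < y.2 →
    halfCost ν x y ≤ K * ‖toR d (y - x)‖ := by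
  obtain ⟨K, hK, h⟩ := exists_halfCost_horizontal_le hν hirr
  obtain ⟨L, hL, h'⟩ := exists_halfCost_vertical_le hν hirr
  refine ⟨K + L, by positivity, fun x y hx hy => ?_⟩
  have h1 := h x (y.1, x.2) hx rfl
  have h2 := h' (y.1, x.2) y hx hy rfl
  have h3 := halfCost_triangle hν hirr hx (y := (y.1, x.2)) hx hy
  have n1 : ‖toR d ((y.1, x.2) - x)‖ ≤ ‖toR d (y - x)‖ := by
    refine (norm_prod_le_iff).2 ⟨norm_fst_le (toR d (y - x)), ?_⟩
    simp [toR]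
  have n2 : ‖toR d (y - (y.1, x.2))‖ ≤ ‖toR d (y - x)‖ := by
    refine (norm_prod_le_iff).2 ⟨?_, norm_snd_le (toR d (y - x))⟩
    have : (toR d (y - (y.1, x.2))).1 = 0 := by ext i; simp [toR]
    rw [this, norm_zero]
    positivity
  nlinarith [mul_le_mul_of_nonneg_left n1 hK, mul_le_mul_of_nonneg_left n2 hL]

include hν hirr in
lemma freeCost_le_of_halfCost_le {K : ℝ}
    (hK : ∀ x y : Zd d, 0 < x.2 → 0 < y.2 → halfCost ν x y ≤ K * ‖toR d (y - x)‖) (w : Zd d) :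
    freeCost ν w ≤ K * ‖toR d w‖ := by
  set s : Zd d := (0, 1 + |w.2|) with hs
  have h1 : 0 < s.2 := by simp only [hs]; positivity
  have h2 : 0 < (w + s).2 := by
    simp only [hs, Prod.snd_add]
    linarith [neg_abs_le w.2]
  have h := (freeCost_le_halfCost hν hirr h1 h2).trans (hK s (w + s) h1 h2)
  simpa using h

end

end Costs

section Duality

variable {d : ℕ}

/-- Sublinear regularization on `ℝ^d` of a cost `ρ` on `ℤ^d`. -/
noncomputable def sublinHull (ρ : Zd d → ℝ) (K : ℝ) (x : Rd d) : ℝ :=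
  ⨅ p : {t : ℝ // 0 < t} × Zd d, (ρ p.2 + K * ‖(p.1 : ℝ) • x - toR d p.2‖) / p.1

instance : Nonempty ({t : ℝ // 0 < t} × Zd d) := ⟨(⟨1, one_pos⟩, 0)⟩

lemma exists_linearMap_eq_dotR (g : Rd d →ₗ[ℝ] ℝ) : ∃ a : Rd d, ∀ x, g x = dotR d a x := by
  refine ⟨(fun i => g (Pi.single i 1, 0), g (0, 1)), fun x => ?_⟩
  have hx : x = (∑ i, x.1 i • ((Pi.single i 1, 0) : Rd d)) + x.2 • ((0, 1) : Rd d) := by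
    refine Prod.ext ?_ ?_
    · ext j
      simp [Prod.fst_sum, Finset.sum_apply, Pi.single_apply]
    · simp [Prod.snd_sum]
  conv_lhs => rw [hx]
  simp only [map_add, map_sum, map_smul, smul_eq_mul, dotR]
  congr 1
  · exact Finset.sum_congr rfl fun i _ => mul_comm _ _
  · exact mul_comm _ _

variable {ρ : Zd d → ℝ} {K : ℝ}

lemma sublinHull_le (hK : 0 ≤ K) (hρ : ∀ w, 0 ≤ ρ w) (x : Rd d) {t : ℝ} (ht : 0 < t) (w : Zd d) :
    sublinHull ρ K x ≤ (ρ w + K * ‖t • x - toR d w‖) / t := by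
  refine ciInf_le (f := fun p : {t : ℝ // 0 < t} × Zd d =>
    (ρ p.2 + K * ‖(p.1 : ℝ) • x - toR d p.2‖) / p.1) ⟨0, ?_⟩ (⟨t, ht⟩, w)
  rintro _ ⟨⟨⟨s, hs⟩, v⟩, rfl⟩
  have := hρ v
  dsimp only
  positivity

lemma sublinHull_smul (hK : 0 ≤ K) (hρ : ∀ w, 0 ≤ ρ w) {c : ℝ} (hc : 0 < c) (x : Rd d) :
    sublinHull ρ K (c • x) = c * sublinHull ρ K x := by
  have key : ∀ {c : ℝ} (_ : 0 < c) (x : Rd d),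
      sublinHull ρ K (c • x) ≤ c * sublinHull ρ K x := by
    intro c hc x
    rw [← div_le_iff₀' hc]
    refine le_ciInf ?_
    rintro ⟨⟨t, ht⟩, w⟩
    have h := sublinHull_le hK hρ (c • x) (div_pos ht hc) w
    rw [smul_smul, div_mul_cancel₀ _ hc.ne'] at h
    rw [div_le_iff₀' hc]
    refine h.trans_eq ?_
    field_simp
  refine le_antisymm (key hc x) ?_
  have h := key (inv_pos.2 hc) (c • x)
  rw [inv_smul_smul₀ hc.ne'] at h
  exact (le_inv_mul_iff₀ hc).1 h

lemma sublinHull_add_le (hK : 0 ≤ K) (hρ : ∀ w, 0 ≤ ρ w) (hzero : ρ 0 = 0)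
    (hadd : ∀ u v, ρ (u + v) ≤ ρ u + ρ v) (x y : Rd d) :
    sublinHull ρ K (x + y) ≤ sublinHull ρ K x + sublinHull ρ K y := by
  refine le_of_forall_pos_le_add fun δ hδ => ?_
  obtain ⟨⟨⟨t, ht⟩, w⟩, hw⟩ := exists_lt_of_ciInf_lt
    (show sublinHull ρ K x < sublinHull ρ K x + δ / 3 by linarith)
  obtain ⟨⟨⟨s, hs⟩, v⟩, hv⟩ := exists_lt_of_ciInf_lt
    (show sublinHull ρ K y < sublinHull ρ K y + δ / 3 by linarith)
  dsimp only at hw hv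
  set A := ρ w + K * ‖t • x - toR d w‖ with hA
  set B := ρ v + K * ‖s • y - toR d v‖ with hB
  set c := K * (t * ‖x‖ + s * ‖y‖) with hc
  have hA0 : 0 ≤ A := by have := hρ w; positivity
  have hB0 : 0 ≤ B := by have := hρ v; positivity
  have hc0 : 0 ≤ c := by positivity
  set T := 3 * c / δ + 1 with hT
  have hT0 : 0 < T := by positivity
  set k := ⌊T / t⌋₊ with hk
  set l := ⌊T / s⌋₊ with hl
  have hk1 : (k : ℝ) ≤ T / t := Nat.floor_le (by positivity)
  have hl1 : (l : ℝ) ≤ T / s := Nat.floor_le (by positivity)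
  have hk2 : T / t < k + 1 := Nat.lt_floor_add_one _
  have hl2 : T / s < l + 1 := Nat.lt_floor_add_one _
  have hk3 : k * t ≤ T := (le_div_iff₀ ht).1 hk1
  have hl3 : l * s ≤ T := (le_div_iff₀ hs).1 hl1
  have hk4 : T < (k + 1) * t := (div_lt_iff₀ ht).1 hk2
  have hl4 : T < (l + 1) * s := (div_lt_iff₀ hs).1 hl2
  have hmain := sublinHull_le hK hρ (x + y) hT0 (k • w + l • v)
  have hρ' : ρ (k • w + l • v) ≤ k * ρ w + l * ρ v :=
    (hadd _ _).trans (add_le_add (nsmul_le_of_subadditive hzero.le hadd k w)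
      (nsmul_le_of_subadditive hzero.le hadd l v))
  have hnorm : ‖T • (x + y) - toR d (k • w + l • v)‖
      ≤ (t * ‖x‖ + s * ‖y‖) + (k * ‖t • x - toR d w‖ + l * ‖s • y - toR d v‖) := by
    have heq : T • (x + y) - toR d (k • w + l • v)
        = ((T - k * t) • x + (T - l * s) • y)
          + ((k : ℝ) • (t • x - toR d w) + (l : ℝ) • (s • y - toR d v)) := by
      rw [toR_add, toR_nsmul, toR_nsmul]
      module
    rw [heq]
    refine (norm_add_le _ _).trans (add_le_add ((norm_add_le _ _).trans (add_le_add ?_ ?_))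
      ((norm_add_le _ _).trans (add_le_add ?_ ?_)))
    · rw [norm_smul, Real.norm_eq_abs, abs_of_nonneg (by linarith)]
      exact mul_le_mul_of_nonneg_right (by linarith) (norm_nonneg _)
    · rw [norm_smul, Real.norm_eq_abs, abs_of_nonneg (by linarith)]
      exact mul_le_mul_of_nonneg_right (by linarith) (norm_nonneg _)
    · rw [norm_smul, Real.norm_natCast]
    · rw [norm_smul, Real.norm_natCast]
  have hnum : ρ (k • w + l • v) + K * ‖T • (x + y) - toR d (k • w + l • v)‖
      ≤ k * A + l * B + c := by
    have := mul_le_mul_of_nonneg_left hnorm hK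
    rw [hA, hB, hc]
    linarith
  have hkA : k * A ≤ T / t * A := mul_le_mul_of_nonneg_right hk1 hA0
  have hlB : l * B ≤ T / s * B := mul_le_mul_of_nonneg_right hl1 hB0
  have hcT : c / T ≤ δ / 3 := by
    rw [div_le_iff₀ hT0, hT]
    have : δ / 3 * (3 * c / δ + 1) = c + δ / 3 := by field_simp
    linarith
  calc sublinHull ρ K (x + y) ≤ _ := hmain
    _ ≤ (T / t * A + T / s * B + c) / T := div_le_div_of_nonneg_right (by linarith) hT0.le
    _ = A / t + B / s + c / T := by field_simp
    _ ≤ _ := by linarith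

/-- Duality for subadditive costs: some vector `a` dominated by `ρ` realizes the asymptotic cost
in the direction `q`. -/
lemma exists_dual_vector (hK : 0 ≤ K) (hρ : ∀ w, 0 ≤ ρ w) (hzero : ρ 0 = 0)
    (hadd : ∀ u v, ρ (u + v) ≤ ρ u + ρ v) (q : Rd d) :
    ∃ a : Rd d, (∀ w, dotZ d a w ≤ ρ w) ∧ ∀ δ > 0, ∃ t > 0, ∃ w : Zd d,
      ρ w + K * ‖t • q - toR d w‖ < t * (dotR d a q + δ) := by
  set N := sublinHull ρ K with hN
  have hsmul : ∀ c : ℝ, 0 < c → ∀ x, N (c • x) = c * N x :=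
    fun c hc x => sublinHull_smul hK hρ hc x
  have hNadd : ∀ x y, N (x + y) ≤ N x + N y := sublinHull_add_le hK hρ hzero hadd
  have hN0 : N 0 = 0 := by
    have := hsmul 2 two_pos 0
    rw [smul_zero] at this
    linarith
  have H : ∀ c : ℝ, c • q = 0 → (RingHom.id ℝ c) • N q = 0 := by
    intro c hc
    rcases smul_eq_zero.1 hc with h | h
    · simp [h]
    · simp [h, hN0]
  obtain ⟨g, hg, hgN⟩ := exists_extension_of_le_sublinear
    (LinearPMap.mkSpanSingleton' (σ := RingHom.id ℝ) q (N q) H) N hsmul hNadd (by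
      rintro ⟨x, hx⟩
      obtain ⟨c, rfl⟩ := Submodule.mem_span_singleton.1 hx
      rw [LinearPMap.mkSpanSingleton'_apply]
      simp only [RingHom.id_apply, smul_eq_mul]
      rcases lt_trichotomy c 0 with hc | rfl | hc
      · have h1 := hsmul (-c) (neg_pos.2 hc) (-q)
        rw [smul_neg, neg_smul, neg_neg] at h1
        have h2 := hNadd q (-q)
        rw [add_neg_cancel, hN0] at h2
        rw [h1]
        nlinarith
      · simp [hN0]
      · exact (hsmul c hc q).ge)
  obtain ⟨a, ha⟩ := exists_linearMap_eq_dotR g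
  have hq : dotR d a q = N q := by
    rw [← ha]
    have h := hg ⟨q, Submodule.mem_span_singleton_self q⟩
    exact h.trans (LinearPMap.mkSpanSingleton'_apply_self _ _ _ _)
  refine ⟨a, fun w => ?_, fun δ hδ => ?_⟩
  · have h1 := sublinHull_le hK hρ (toR d w) one_pos w
    rw [one_smul, sub_self, norm_zero, mul_zero, add_zero, div_one] at h1
    have h2 := hgN (toR d w)
    rw [ha] at h2
    exact h2.trans h1
  · obtain ⟨⟨⟨t, ht⟩, w⟩, hw⟩ := exists_lt_of_ciInf_lt (show N q < dotR d a q + δ by linarith)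
    exact ⟨t, ht, w, (div_lt_iff₀' ht).1 hw⟩

end Duality

section GeneratingFunction

variable {d : ℕ}

lemma dotZ_add (a : Rd d) (x y : Zd d) : dotZ d a (x + y) = dotZ d a x + dotZ d a y := by
  simp only [dotZ, Prod.fst_add, Prod.snd_add, Pi.add_apply, Int.cast_add, mul_add,
    Finset.sum_add_distrib]
  ring

lemma dotZ_zero (a : Rd d) : dotZ d a 0 = 0 := by simp [dotZ]

/-- The exponential character `z ↦ e^{a·z}` with values in `ℝ≥0∞`. -/
noncomputable def expChar (a : Rd d) (z : Zd d) : ℝ≥0∞ := ENNReal.ofReal (Real.exp (dotZ d a z))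

lemma expChar_add (a : Rd d) (x y : Zd d) :
    expChar a (x + y) = expChar a x * expChar a y := by
  rw [expChar, dotZ_add, Real.exp_add, ENNReal.ofReal_mul (Real.exp_pos _).le]
  rfl

lemma expChar_zero (a : Rd d) : expChar a 0 = 1 := by simp [expChar, dotZ_zero]

/-- The cube of side `2 * N + 1` centered at the origin of `ℤ^d`. -/
noncomputable def box (d N : ℕ) : Finset (Zd d) :=
  (Fintype.piFinset fun _ => Finset.Icc (-(N : ℤ)) N) ×ˢ Finset.Icc (-(N : ℤ)) N

lemma mem_box {N : ℕ} {y : Zd d} :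
    y ∈ box d N ↔ (∀ i, -(N : ℤ) ≤ y.1 i ∧ y.1 i ≤ N) ∧ -(N : ℤ) ≤ y.2 ∧ y.2 ≤ N := by
  simp [box]

lemma card_box (N : ℕ) : (box d N).card = (2 * N + 1) ^ (d - 1 + 1) := by
  have h : ((N : ℤ) + 1 + N).toNat = 2 * N + 1 := by omega
  simp [box, h, pow_succ]

lemma add_mem_box {M N : ℕ} {x y : Zd d} (hx : x ∈ box d M) (hy : y ∈ box d N) :
    x + y ∈ box d (M + N) := by
  rw [mem_box] at *
  refine ⟨fun i => ?_, ?_⟩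
  · have h1 := hx.1 i
    have h2 := hy.1 i
    simp only [Prod.fst_add, Pi.add_apply]
    omega
  · simp only [Prod.snd_add]
    omega

lemma kerIter_mem_box {ν : Zd d → ℝ≥0∞} {R : ℕ} (hν : ∀ u, ν u ≠ 0 → u ∈ box d R) (n : ℕ)
    (y : Zd d) (hy : kerIter (fun x y => ν (y - x)) n 0 y ≠ 0) : y ∈ box d (n * R) := by
  induction n generalizing y with
  | zero =>
    have : (0 : Zd d) = y := by
      by_contra hne
      simp [kerIter, hne] at hy
    simp [← this, mem_box]
  | succ n ih =>
    simp only [kerIter] at hy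
    obtain ⟨w, hw⟩ : ∃ w, kerIter (fun x y => ν (y - x)) n 0 w * ν (y - w) ≠ 0 := by
      by_contra! hall
      simp [hall] at hy
    rw [mul_ne_zero_iff] at hw
    have h := add_mem_box (ih w hw.1) (hν _ hw.2)
    rwa [add_sub_cancel, ← Nat.succ_mul] at h

lemma exists_box (F : Finset (Zd d)) : ∃ R : ℕ, ∀ u ∈ F, u ∈ box d R := by
  refine ⟨F.sup fun u => (Finset.univ.sup fun i => (u.1 i).natAbs) ⊔ u.2.natAbs, fun u hu => ?_⟩
  have h := Finset.le_sup (f := fun u : Zd d =>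
    (Finset.univ.sup fun i => (u.1 i).natAbs) ⊔ u.2.natAbs) hu
  set R := F.sup fun u => (Finset.univ.sup fun i => (u.1 i).natAbs) ⊔ u.2.natAbs
  have h1 : ∀ i, (u.1 i).natAbs ≤ R := fun i =>
    (Finset.le_sup (f := fun i => (u.1 i).natAbs) (Finset.mem_univ i)).trans (le_sup_left.trans h)
  have h2 : u.2.natAbs ≤ R := le_sup_right.trans h
  refine mem_box.2 ⟨fun i => ?_, by omega⟩
  have := h1 i
  omega

lemma le_one_of_pow_le_polynomial {x : ℝ} {R k : ℕ}
    (h : ∀ n : ℕ, x ^ n ≤ (2 * (n * R) + 1 : ℝ) ^ k) : x ≤ 1 := by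
  by_contra! hx
  have hlim := (tendsto_pow_const_div_const_pow_of_one_lt k hx).const_mul ((2 * R + 1 : ℝ) ^ k)
  rw [mul_zero] at hlim
  obtain ⟨n, hn, hn1⟩ :=
    ((hlim.eventually (gt_mem_nhds one_pos)).and (eventually_ge_atTop 1)).exists
  have hxn : 0 < x ^ n := by positivity
  have hn1' : (1 : ℝ) ≤ n := by exact_mod_cast hn1
  rw [← mul_div_assoc, ← mul_pow, div_lt_one hxn] at hn
  have h2 : (2 * (n * R) + 1 : ℝ) ^ k ≤ ((2 * R + 1) * n) ^ k := by
    refine pow_le_pow_left₀ (by positivity) ?_ k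
    nlinarith
  linarith [h n]

/-- If all iterated convolutions of `ν` are dominated by `e^{-a·w}`, then the generating function
of `ν` at `a` is at most one. -/
lemma tsum_mul_expChar_le_one {ν : Zd d → ℝ≥0∞} (hν : ∀ u, ν u ≠ ⊤) (a : Rd d)
    (h : ∀ n w, kerIter (fun x y => ν (y - x)) n 0 w * expChar a w ≤ 1) :
    ∑' u, ν u * expChar a u ≤ 1 := by
  classical
  rw [ENNReal.tsum_eq_iSup_sum]
  refine iSup_le fun F => ?_
  obtain ⟨R, hR⟩ := exists_box F
  set νF : Zd d → ℝ≥0∞ := fun u => if u ∈ F then ν u else 0 with hνF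
  have hle : ∀ u, νF u ≤ ν u := fun u => by
    simp only [hνF]
    split_ifs <;> simp
  have hsum : ∑' u, νF u * expChar a u = ∑ u ∈ F, ν u * expChar a u := by
    rw [tsum_eq_sum (s := F)]
    · exact Finset.sum_congr rfl fun u hu => by simp [hνF, hu]
    · intro u hu
      simp [hνF, hu]
  have hpow : ∀ n : ℕ, (∑ u ∈ F, ν u * expChar a u) ^ n
      ≤ ((2 * (n * R) + 1 : ℕ) : ℝ≥0∞) ^ (d - 1 + 1) := by
    intro n
    have hgen := tsum_kerIter_mul νF (expChar a) (expChar_add a) n 0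
    rw [hsum, expChar_zero, mul_one] at hgen
    rw [← hgen, tsum_eq_sum (s := box d (n * R))]
    · calc _ ≤ ∑ y ∈ box d (n * R), (1 : ℝ≥0∞) :=
            Finset.sum_le_sum fun y _ => le_trans (mul_le_mul'
              (kerIter_mono (fun x y => hle (y - x)) n 0 y) le_rfl) (h n y)
        _ = _ := by
          rw [Finset.sum_const, card_box, nsmul_one]
          push_cast
          rfl
    · intro y hy
      by_contra hne
      refine hy (kerIter_mem_box (fun u hu => hR u ?_) n y (left_ne_zero_of_mul hne))
      by_contra huF
      simp [hνF, huF] at hu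
  have hfin : ∑ u ∈ F, ν u * expChar a u ≠ ⊤ :=
    ENNReal.sum_ne_top.2 fun u _ => ENNReal.mul_ne_top (hν u) ENNReal.ofReal_ne_top
  have hreal : (∑ u ∈ F, ν u * expChar a u).toReal ≤ 1 := by
    refine le_one_of_pow_le_polynomial (R := R) (k := d - 1 + 1) fun n => ?_
    have h1 := ENNReal.toReal_mono (by finiteness) (hpow n)
    rw [ENNReal.toReal_pow, ENNReal.toReal_pow, ENNReal.toReal_natCast] at h1
    exact_mod_cast h1
  rw [← ENNReal.ofReal_toReal hfin]
  exact ENNReal.ofReal_le_one.2 hreal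

lemma ofReal_jgf {μ : Zd d → ℝ} (hμ : ∀ z, 0 ≤ μ z) {a : Rd d}
    (ha : Summable fun z => μ z * Real.exp (dotZ d a z)) :
    ENNReal.ofReal (jgf d μ a) = ∑' u, ENNReal.ofReal (μ u) * expChar a u := by
  rw [jgf, ENNReal.ofReal_tsum_of_nonneg (fun z => mul_nonneg (hμ z) (Real.exp_pos _).le) ha]
  exact tsum_congr fun z => ENNReal.ofReal_mul (hμ z)

lemma kerIter_mul_expChar_le (ν : Zd d → ℝ≥0∞) (a : Rd d) (n : ℕ) (x y : Zd d) :
    kerIter (fun x y => ν (y - x)) n x y * expChar a y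
      ≤ (∑' u, ν u * expChar a u) ^ n * expChar a x :=
  (ENNReal.le_tsum y).trans_eq (tsum_kerIter_mul ν (expChar a) (expChar_add a) n x)

lemma expChar_pos (a : Rd d) (x : Zd d) : 0 < expChar a x := ENNReal.ofReal_pos.2 (Real.exp_pos _)

lemma expChar_ne_top (a : Rd d) (x : Zd d) : expChar a x ≠ ⊤ := ENNReal.ofReal_ne_top

lemma tsum_kerIter_halfKer_le {ν : Zd d → ℝ≥0∞} {a : Rd d}
    (x y : Zd d) :
    ∑' n, kerIter (halfKer ν) n x y
      ≤ (1 - ∑' u, ν u * expChar a u)⁻¹ * expChar a x * (expChar a y)⁻¹ := by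
  rw [← div_eq_mul_inv, ENNReal.le_div_iff_mul_le (Or.inl (expChar_pos a y).ne')
    (Or.inl (expChar_ne_top a y)), ← ENNReal.tsum_geometric, ← ENNReal.tsum_mul_right,
    ← ENNReal.tsum_mul_right]
  exact ENNReal.tsum_le_tsum fun n => (mul_le_mul' (kerIter_mono (halfKer_le ν) n x y) le_rfl).trans
    (kerIter_mul_expChar_le ν a n x y)

lemma maxKer_mul_expChar_le_one {ν : Zd d → ℝ≥0∞} {a : Rd d}
    (ha : ∑' u, ν u * expChar a u ≤ 1) (w : Zd d) :
    maxKer (fun x y => ν (y - x)) 0 w * expChar a w ≤ 1 := by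
  rw [maxKer, ENNReal.iSup_mul]
  refine iSup_le fun n => (kerIter_mul_expChar_le ν a n 0 w).trans ?_
  rw [expChar_zero, mul_one]
  exact pow_le_one₀ zero_le ha

lemma mul_expChar_le_one_iff {m : ℝ≥0∞} (hm : 0 < m) (hm' : m ≠ ⊤) (a : Rd d) (w : Zd d) :
    m * expChar a w ≤ 1 ↔ dotZ d a w ≤ -Real.log m.toReal := by
  have hpos := ENNReal.toReal_pos hm.ne' hm'
  rw [← ENNReal.ofReal_toReal hm', expChar, ← ENNReal.ofReal_mul ENNReal.toReal_nonneg,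
    ENNReal.ofReal_le_one, ENNReal.toReal_ofReal ENNReal.toReal_nonneg]
  conv_lhs => rw [← Real.exp_log hpos, ← Real.exp_add, Real.exp_le_one_iff]
  constructor <;> intro h <;> linarith

lemma dotZ_le_freeCost {ν : Zd d → ℝ≥0∞} (hν : ∑' u, ν u = 1)
    (hirr : AddSubmonoid.closure {u | ν u ≠ 0} = ⊤) {a : Rd d}
    (ha : ∑' u, ν u * expChar a u ≤ 1) (w : Zd d) : dotZ d a w ≤ freeCost ν w :=
  (mul_expChar_le_one_iff (maxKer_free_pos hirr w)
    ((maxKer_le_one hν 0 w).trans_lt ENNReal.one_lt_top).ne a w).1 (maxKer_mul_expChar_le_one ha w)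

lemma tsum_mul_expChar_le_one_of_dotZ_le {ν : Zd d → ℝ≥0∞} (hν : ∑' u, ν u = 1)
    (hirr : AddSubmonoid.closure {u | ν u ≠ 0} = ⊤) {a : Rd d}
    (ha : ∀ w, dotZ d a w ≤ freeCost ν w) : ∑' u, ν u * expChar a u ≤ 1 := by
  refine tsum_mul_expChar_le_one (fun u => ?_) a fun n w => ?_
  · exact ((ENNReal.le_tsum u).trans_lt (hν ▸ ENNReal.one_lt_top)).ne
  · refine (mul_le_mul' (le_maxKer _ n 0 w) le_rfl).trans ?_
    exact (mul_expChar_le_one_iff (maxKer_free_pos hirr w)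
      ((maxKer_le_one hν 0 w).trans_lt ENNReal.one_lt_top).ne a w).2 (ha w)

end GeneratingFunction

section Domain

variable {d : ℕ}

lemma exp_le_one_add_add_sq_mul (x : ℝ) : Real.exp x ≤ 1 + x + x ^ 2 * Real.exp |x| := by
  have h1 : Real.exp x ≤ 1 + x * Real.exp x := by
    have h := Real.add_one_le_exp (-x)
    rw [Real.exp_neg] at h
    have h' := mul_le_mul_of_nonneg_left h (Real.exp_pos x).le
    rw [mul_inv_cancel₀ (Real.exp_pos x).ne'] at h'
    linarith
  rcases le_total 0 x with hx | hx
  · rw [abs_of_nonneg hx]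
    nlinarith
  · have h2 := Real.add_one_le_exp x
    have h3 : 1 ≤ Real.exp |x| := Real.one_le_exp (abs_nonneg x)
    nlinarith [mul_le_mul_of_nonneg_left h3 (sq_nonneg x)]

lemma exp_mul_le_quadratic (b : ℝ) {s : ℝ} (hs : |s| ≤ 1) :
    Real.exp (s * b) ≤ 1 + s * b + s ^ 2 * (2 * (Real.exp (2 * b) + Real.exp (-2 * b))) := by
  have h1 := exp_le_one_add_add_sq_mul (s * b)
  have h2 : Real.exp |s * b| ≤ Real.exp |b| := by
    rw [Real.exp_le_exp, abs_mul]
    exact mul_le_of_le_one_left (abs_nonneg b) hs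
  have h3 : b ^ 2 ≤ 2 * Real.exp |b| := by
    have h := Real.quadratic_le_exp_of_nonneg (abs_nonneg b)
    rw [sq_abs] at h
    linarith [abs_nonneg b]
  have h4 : Real.exp |b| * Real.exp |b| ≤ Real.exp (2 * b) + Real.exp (-2 * b) := by
    rw [← Real.exp_add]
    rcases abs_cases b with ⟨hb, _⟩ | ⟨hb, _⟩ <;> rw [hb]
    · rw [← two_mul]
      linarith [Real.exp_pos (-2 * b)]
    · rw [show -b + -b = -2 * b by ring]
      linarith [Real.exp_pos (2 * b)]
  have h5 : b ^ 2 * Real.exp |s * b| ≤ 2 * (Real.exp (2 * b) + Real.exp (-2 * b)) := by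
    calc b ^ 2 * Real.exp |s * b| ≤ 2 * Real.exp |b| * Real.exp |b| :=
          mul_le_mul h3 h2 (Real.exp_pos _).le (by positivity)
      _ ≤ _ := by linarith
  nlinarith [mul_le_mul_of_nonneg_left h5 (sq_nonneg s)]

lemma abs_le_exp_add_exp (b : ℝ) : |b| ≤ Real.exp (2 * b) + Real.exp (-2 * b) := by
  have h1 := Real.add_one_le_exp (2 * b)
  have h2 := Real.add_one_le_exp (-2 * b)
  have h3 := Real.exp_pos (2 * b)
  have h4 := Real.exp_pos (-2 * b)
  rcases abs_cases b with ⟨hb, _⟩ | ⟨hb, _⟩ <;> rw [hb] <;> linarith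

/-- If the Laplace transform of `b` is minimal at the origin then `b` is centered. -/
lemma tsum_mul_eq_zero_of_one_le {α : Type*} {μ b : α → ℝ} (hμ : ∀ z, 0 ≤ μ z) (hsum : HasSum μ 1)
    (hexp : ∀ s : ℝ, Summable fun z => μ z * Real.exp (s * b z))
    (hge : ∀ s : ℝ, 1 ≤ ∑' z, μ z * Real.exp (s * b z)) : ∑' z, μ z * b z = 0 := by
  set g : α → ℝ := fun z => μ z * Real.exp (2 * b z) + μ z * Real.exp (-2 * b z) with hg
  have hgs : Summable g := (hexp 2).add (hexp (-2))
  have hg0 : ∀ z, 0 ≤ g z := fun z => by have := hμ z; positivity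
  have hb : Summable fun z => μ z * b z := by
    refine hgs.of_norm_bounded fun z => ?_
    rw [Real.norm_eq_abs, abs_mul, abs_of_nonneg (hμ z), hg]
    dsimp only
    rw [← mul_add]
    exact mul_le_mul_of_nonneg_left (abs_le_exp_add_exp (b z)) (hμ z)
  set M := ∑' z, μ z * b z with hM
  set B := 2 * ∑' z, g z with hB
  have hB0 : 0 ≤ B := mul_nonneg two_pos.le (tsum_nonneg hg0)
  have key : ∀ s : ℝ, |s| ≤ 1 → 0 ≤ s * M + s ^ 2 * B := by
    intro s hs
    have h1 : HasSum (fun z => μ z + (s * (μ z * b z) + s ^ 2 * (2 * g z)))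
        (1 + (s * M + s ^ 2 * B)) :=
      hsum.add ((hb.hasSum.mul_left s).add ((hgs.hasSum.mul_left 2).mul_left (s ^ 2)))
    have h2 := hasSum_le (fun z => ?_) (hexp s).hasSum h1
    · linarith [hge s]
    · have h := mul_le_mul_of_nonneg_left (exp_mul_le_quadratic (b z) hs) (hμ z)
      simp only [hg]
      linarith
  by_contra hne
  have hMpos : 0 < |M| := abs_pos.2 hne
  set c := |M| + B + 1 with hc
  have hcpos : 0 < c := by positivity
  have h := key (-M / c) (by
    rw [abs_div, abs_neg, abs_of_pos hcpos, div_le_one hcpos]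
    linarith)
  have heq : -M / c * M + (-M / c) ^ 2 * B = -(M ^ 2 * (|M| + 1)) / c ^ 2 := by
    field_simp
    rw [hc]
    ring
  rw [heq] at h
  have hneg : -(M ^ 2 * (|M| + 1)) / c ^ 2 < 0 := by
    refine div_neg_of_neg_of_pos (neg_neg_of_pos ?_) (by positivity)
    have : 0 < M ^ 2 := by positivity
    positivity
  linarith

lemma exists_jgf_lt_one {μ : Zd d → ℝ} (hμ : IsProb d μ)
    (hexp : ∀ a : Rd d, Summable fun z => μ z * Real.exp (dotZ d a z))
    (hm : meanVec d μ ≠ 0) : ∃ a : Rd d, jgf d μ a < 1 := by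
  by_contra! hge
  have key : ∀ v : Rd d, ∑' z, μ z * dotZ d v z = 0 := by
    intro v
    have hdot : ∀ (s : ℝ) z, s * dotZ d v z = dotZ d (s • v) z := by
      intro s z
      simp [dotZ, mul_add, Finset.mul_sum, mul_assoc]
    refine tsum_mul_eq_zero_of_one_le hμ.1 hμ.2 (fun s => ?_) fun s => ?_
    · simpa only [hdot] using hexp (s • v)
    · simpa only [hdot, jgf] using hge (s • v)
  apply hm
  refine Prod.ext ?_ ?_
  · ext i
    have h := key (Pi.single i 1, 0)
    simpa [dotZ, meanVec, Pi.single_apply] using h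
  · have h := key (0, 1)
    simpa [dotZ, meanVec] using h

lemma jgf_convex_comb_le {μ : Zd d → ℝ} (hμ : ∀ z, 0 ≤ μ z)
    (hexp : ∀ a : Rd d, Summable fun z => μ z * Real.exp (dotZ d a z)) (a b : Rd d) {s t : ℝ}
    (hs : 0 ≤ s) (ht : 0 ≤ t) (hst : s + t = 1) :
    jgf d μ (s • a + t • b) ≤ s * jgf d μ a + t * jgf d μ b := by
  refine hasSum_le (fun z => ?_) (hexp _).hasSum
    (((hexp a).hasSum.mul_left s).add ((hexp b).hasSum.mul_left t))
  have hdot : dotZ d (s • a + t • b) z = s • dotZ d a z + t • dotZ d b z := by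
    simp only [dotZ, Prod.fst_add, Prod.snd_add, Prod.smul_fst, Prod.smul_snd, Pi.add_apply,
      Pi.smul_apply, smul_eq_mul, add_mul, Finset.sum_add_distrib, mul_add, Finset.mul_sum,
      mul_assoc]
    ring
  have h := convexOn_exp.2 (Set.mem_univ (dotZ d a z)) (Set.mem_univ (dotZ d b z)) hs ht hst
  rw [← hdot, smul_eq_mul, smul_eq_mul] at h
  have h' := mul_le_mul_of_nonneg_left h (hμ z)
  linarith

lemma dotR_comb (a b q : Rd d) (s t : ℝ) :
    dotR d (s • a + t • b) q = s * dotR d a q + t * dotR d b q := by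
  simp only [dotR, Prod.fst_add, Prod.snd_add, Prod.smul_fst, Prod.smul_snd, Pi.add_apply,
    Pi.smul_apply, smul_eq_mul, add_mul, Finset.sum_add_distrib, mul_add, Finset.mul_sum, mul_assoc]
  ring

lemma dotR_smul (a q : Rd d) (s : ℝ) : dotR d a (s • q) = s * dotR d a q := by
  simp only [dotR, Prod.smul_fst, Prod.smul_snd, Pi.smul_apply, smul_eq_mul, mul_add,
    Finset.mul_sum]
  congr 1
  · exact Finset.sum_congr rfl fun i _ => by ring
  · ring

lemma continuous_dotR (a : Rd d) : Continuous (dotR d a) := by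
  unfold dotR
  fun_prop

/-- Linear forms near their supremum on `{φ ≤ 1}` can be approximated from `{φ < 1}`. -/
lemma exists_jgf_lt_one_of_lt_dotR {μ : Zd d → ℝ} (hμ : IsProb d μ)
    (hexp : ∀ a : Rd d, Summable fun z => μ z * Real.exp (dotZ d a z))
    (hm : meanVec d μ ≠ 0) {a q : Rd d} (ha : jgf d μ a ≤ 1) {c : ℝ} (hc : c < dotR d a q) :
    ∃ b : Rd d, jgf d μ b < 1 ∧ c < dotR d b q := by
  obtain ⟨a₀, ha₀⟩ := exists_jgf_lt_one hμ hexp hm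
  have hcont : Continuous fun t : ℝ => (1 - t) * dotR d a q + t * dotR d a₀ q := by fun_prop
  have hlim := hcont.tendsto 0
  simp only [sub_zero, one_mul, zero_mul, add_zero] at hlim
  have hev := (hlim.eventually (lt_mem_nhds hc)).filter_mono nhdsWithin_le_nhds
    |>.and (Ioo_mem_nhdsGT (zero_lt_one (α := ℝ)))
  obtain ⟨t, ht, ht0, ht1⟩ := hev.exists
  refine ⟨(1 - t) • a + t • a₀, ?_, by rwa [dotR_comb]⟩
  have h := jgf_convex_comb_le hμ.1 hexp a a₀ (sub_nonneg.2 ht1.le) ht0.le (sub_add_cancel 1 t)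
  nlinarith

end Domain

section Asymptotics

variable {d : ℕ}

lemma tsum_ofReal_eq_one {μ : Zd d → ℝ} (hμ : IsProb d μ) : ∑' u, ENNReal.ofReal (μ u) = 1 := by
  rw [← ENNReal.ofReal_tsum_of_nonneg hμ.1 hμ.2.summable, hμ.2.tsum_eq, ENNReal.ofReal_one]

lemma closure_support_eq_top {μ : Zd d → ℝ} (h : ∀ z z' : Zd d, ∃ n : ℕ, 0 < stepSn d μ n z z') :
    AddSubmonoid.closure {u | ENNReal.ofReal (μ u) ≠ 0} = ⊤ := by
  refine (AddSubmonoid.eq_top_iff' _).2 fun w => ?_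
  obtain ⟨n, hn⟩ := h 0 w
  simpa using mem_closure_of_kerIter_pos (fun u => ENNReal.ofReal (μ u)) n 0 w hn

lemma greenPlus_eq_tsum_kerIter (μ μ0 : Zd d → ℝ) {z : St d} (hz : z.2 ≠ 0) (z' : St d) :
    greenPlus d μ μ0 z z'
      = ∑' n, kerIter (halfKer fun u => ENNReal.ofReal (μ u)) n (toZ d z) (toZ d z') :=
  tsum_congr fun n => stepKilledn_eq_kerIter μ μ0 n z z' hz

lemma mem_Dset_iff {μ : Zd d → ℝ} (hμ : ∀ z, 0 ≤ μ z)
    (hexp : ∀ a : Rd d, Summable fun z => μ z * Real.exp (dotZ d a z)) {a : Rd d} :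
    a ∈ Dset d μ ↔ ∑' u, ENNReal.ofReal (μ u) * expChar a u ≤ 1 := by
  rw [← ofReal_jgf hμ (hexp a), ENNReal.ofReal_le_one]
  rfl

lemma norm_le_of_dotZ_le {ρ : Zd d → ℝ} {K : ℝ} (hK : 0 ≤ K) (hρ : ∀ w, ρ w ≤ K * ‖toR d w‖)
    {a : Rd d} (ha : ∀ w, dotZ d a w ≤ ρ w) : ‖a‖ ≤ K := by
  have h1 : ∀ w, dotZ d a w ≤ K * ‖toR d w‖ := fun w => (ha w).trans (hρ w)
  have hle : ∀ w, ‖toR d w‖ ≤ 1 → dotZ d a w ≤ K := fun w hw =>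
    (h1 w).trans (mul_le_of_le_one_right hK hw)
  have hsingle : ∀ (i : Fin (d - 1)) (s : ℤ), |(s : ℝ)| ≤ 1 → a.1 i * s ≤ K := by
    intro i s hs
    have h := hle (Pi.single i s, 0) ?_
    · simpa [dotZ, Pi.single_apply] using h
    · simp only [toR, Prod.norm_mk, Int.cast_zero, norm_zero]
      refine max_le ((pi_norm_le_iff_of_nonneg zero_le_one).2 fun j => ?_) zero_le_one
      rcases eq_or_ne j i with rfl | hj
      · simpa using hs
      · simp [hj]
  have hlast : ∀ s : ℤ, |(s : ℝ)| ≤ 1 → a.2 * s ≤ K := by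
    intro s hs
    have h := hle (0, s) ?_
    · simpa [dotZ] using h
    · simp only [toR, Prod.norm_mk, Pi.zero_apply, Int.cast_zero]
      refine max_le ((pi_norm_le_iff_of_nonneg zero_le_one).2 fun j => ?_) hs
      simp
  refine (Prod.norm_def a).trans_le (max_le ((pi_norm_le_iff_of_nonneg hK).2 fun i => ?_) ?_)
  · have h1 := hsingle i 1 (by simp)
    have h2 := hsingle i (-1) (by simp)
    push_cast at h1 h2
    exact abs_le.2 ⟨by linarith, by linarith⟩
  · have h1 := hlast 1 (by simp)
    have h2 := hlast (-1) (by simp)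
    push_cast at h1 h2
    exact abs_le.2 ⟨by linarith, by linarith⟩

lemma dotR_le_of_norm_le {a : Rd d} {K : ℝ} (ha : ‖a‖ ≤ K) (q : Rd d) :
    dotR d a q ≤ K * ((∑ i, |q.1 i|) + |q.2|) := by
  have key : ∀ s t : ℝ, |s| ≤ K → s * t ≤ K * |t| := fun s t hs =>
    (le_abs_self _).trans ((abs_mul s t).trans_le (mul_le_mul_of_nonneg_right hs (abs_nonneg t)))
  rw [dotR, mul_add, Finset.mul_sum]
  exact add_le_add
    (Finset.sum_le_sum fun i _ => key _ _
      ((norm_le_pi_norm a.1 i).trans ((norm_fst_le a).trans ha)))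
    (key _ _ ((norm_snd_le a).trans ha))

section Bounds

variable {ν : Zd d → ℝ≥0∞} (hν : ∑' u, ν u = 1)
  (hirr : AddSubmonoid.closure {u | ν u ≠ 0} = ⊤)

lemma tsum_kerIter_halfKer_ne_top {a : Rd d} (ha : ∑' u, ν u * expChar a u < 1) (x y : Zd d) :
    ∑' n, kerIter (halfKer ν) n x y ≠ ⊤ := by
  refine ((tsum_kerIter_halfKer_le (a := a) x y).trans_lt ?_).ne
  exact ENNReal.mul_lt_top (ENNReal.mul_lt_top (ENNReal.inv_lt_top.2 (tsub_pos_of_lt ha))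
    (expChar_ne_top a x).lt_top) (ENNReal.inv_lt_top.2 (expChar_pos a y))

include hirr in
/-- Exponential Chernoff bound for the Green's function of the killed walk. -/
lemma exists_log_green_le {a : Rd d} (ha : ∑' u, ν u * expChar a u < 1) {x : Zd d} (hx : 0 < x.2) :
    ∃ C : ℝ, ∀ y : Zd d, 0 < y.2 →
      Real.log (∑' n, kerIter (halfKer ν) n x y).toReal ≤ C - dotZ d a y := by
  set A : ℝ≥0∞ := (1 - ∑' u, ν u * expChar a u)⁻¹ * expChar a x with hA
  have hAtop : A ≠ ⊤ := (ENNReal.mul_lt_top (ENNReal.inv_lt_top.2 (tsub_pos_of_lt ha))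
    (expChar_ne_top a x).lt_top).ne
  have hA0 : 0 < A := ENNReal.mul_pos
    (ENNReal.inv_ne_zero.2 (tsub_le_self.trans_lt ENNReal.one_lt_top).ne) (expChar_pos a x).ne'
  have hA' := ENNReal.toReal_pos hA0.ne' hAtop
  refine ⟨Real.log A.toReal, fun y hy => ?_⟩
  have hpos : 0 < ∑' n, kerIter (halfKer ν) n x y :=
    (maxKer_halfKer_pos hirr hx hy).trans_le (maxKer_le_tsum _ x y)
  have hle := tsum_kerIter_halfKer_le (ν := ν) (a := a) x y
  have htop : A * (expChar a y)⁻¹ ≠ ⊤ :=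
    (ENNReal.mul_lt_top hAtop.lt_top (ENNReal.inv_lt_top.2 (expChar_pos a y))).ne
  have h := Real.log_le_log (ENNReal.toReal_pos hpos.ne' (tsum_kerIter_halfKer_ne_top ha x y))
    (ENNReal.toReal_mono htop hle)
  rwa [ENNReal.toReal_mul, ENNReal.toReal_inv, expChar,
    ENNReal.toReal_ofReal (Real.exp_pos _).le,
    Real.log_mul hA'.ne' (inv_pos.2 (Real.exp_pos _)).ne', Real.log_inv, Real.log_exp,
    ← sub_eq_add_neg] at h

include hν hirr in
lemma neg_halfCost_le_log_green {x y : Zd d} (hx : 0 < x.2) (hy : 0 < y.2)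
    (h : ∑' n, kerIter (halfKer ν) n x y ≠ ⊤) :
    -halfCost ν x y ≤ Real.log (∑' n, kerIter (halfKer ν) n x y).toReal := by
  rw [halfCost, neg_neg]
  exact Real.log_le_log (ENNReal.toReal_pos (maxKer_halfKer_pos hirr hx hy).ne'
    ((maxKer_halfKer_le_one hν x y).trans_lt ENNReal.one_lt_top).ne)
    (ENNReal.toReal_mono h (maxKer_le_tsum _ x y))

include hν hirr in
/-- Far from the boundary, the killed walk performs a displacement at nearly the free cost. -/
lemma exists_halfCost_add_le_freeCost_add (w : Zd d) {η : ℝ} (hη : 0 < η) :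
    ∃ j : ℕ, ∀ v : Zd d, 0 ≤ v.2 →
      halfCost ν ((0, (j : ℤ)) + v) (w + ((0, (j : ℤ)) + v)) ≤ freeCost ν w + η := by
  set m := maxKer (fun x y => ν (y - x)) 0 w with hm
  have hm0 : 0 < m := maxKer_free_pos hirr w
  have hmtop : m ≠ ⊤ := ((maxKer_le_one hν 0 w).trans_lt ENNReal.one_lt_top).ne
  have hexp : ENNReal.ofReal (Real.exp (-η)) < 1 := by
    rw [ENNReal.ofReal_lt_one, Real.exp_lt_one_iff]
    linarith
  have hc : ENNReal.ofReal (Real.exp (-η)) * m < m := by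
    conv_rhs => rw [← one_mul m]
    exact ENNReal.mul_lt_mul_left hm0.ne' hmtop hexp
  obtain ⟨j, hj⟩ := exists_lt_maxKer_halfKer ν w _ hc
  refine ⟨j, fun v hv => ?_⟩
  have hle := hj.le.trans (maxKer_halfKer_le_add ν (0, (j : ℤ)) (w + (0, (j : ℤ))) v hv)
  rw [add_assoc] at hle
  have hpos : 0 < ENNReal.ofReal (Real.exp (-η)) * m :=
    ENNReal.mul_pos (ENNReal.ofReal_pos.2 (Real.exp_pos _)).ne' hm0.ne'
  refine (neg_log_toReal_le hpos hle (maxKer_halfKer_le_one hν _ _)).trans_eq ?_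
  rw [ENNReal.toReal_mul, ENNReal.toReal_ofReal (Real.exp_pos _).le,
    Real.log_mul (Real.exp_pos _).ne' (ENNReal.toReal_pos hm0.ne' hmtop).ne', Real.log_exp,
    freeCost]
  ring

include hν hirr in
lemma exists_halfCost_le_nsmul {K : ℝ} (hK : 0 ≤ K)
    (hKle : ∀ x y : Zd d, 0 < x.2 → 0 < y.2 → halfCost ν x y ≤ K * ‖toR d (y - x)‖)
    {w : Zd d} (hw : 0 ≤ w.2) {η : ℝ} (hη : 0 < η) {x : Zd d} (hx : 0 < x.2) :
    ∃ C : ℝ, ∀ (k : ℕ) (y : Zd d), 0 < y.2 →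
      halfCost ν x y ≤ C + (k * (freeCost ν w + η) + K * ‖toR d y - (k : ℝ) • toR d w‖) := by
  obtain ⟨j, hj⟩ := exists_halfCost_add_le_freeCost_add hν hirr w hη
  set x₀ : Zd d := (0, (j : ℤ)) + x with hx₀
  have hx₀pos : 0 < x₀.2 := by
    simp only [hx₀, Prod.snd_add]
    positivity
  have hpos : ∀ k : ℕ, 0 < (k • w + x₀).2 := fun k => by
    simp only [Prod.snd_add, Prod.smul_snd]
    positivity
  have hray : ∀ k : ℕ, halfCost ν x₀ (k • w + x₀) ≤ k * (freeCost ν w + η) := by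
    intro k
    induction k with
    | zero => simp [halfCost_self hν]
    | succ k ih =>
      have h1 := halfCost_triangle hν hirr hx₀pos (hpos k) (hpos (k + 1))
      have h2 := hj (x + k • w) (by
        simp only [Prod.snd_add, Prod.smul_snd]
        positivity)
      rw [← add_assoc, ← hx₀, add_comm x₀ (k • w), ← add_assoc w, add_comm w, ← succ_nsmul] at h2
      push_cast
      linarith
  refine ⟨halfCost ν x x₀ + K * ‖toR d x₀‖, fun k y hy => ?_⟩
  have h1 := halfCost_triangle hν hirr hx hx₀pos hy
  have h2 := halfCost_triangle hν hirr hx₀pos (hpos k) hy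
  have h3 := hKle _ y (hpos k) hy
  have h4 : ‖toR d (y - (k • w + x₀))‖ ≤ ‖toR d y - (k : ℝ) • toR d w‖ + ‖toR d x₀‖ := by
    rw [toR_sub, toR_add, toR_nsmul, ← sub_sub]
    exact norm_sub_le _ _
  have h5 := mul_le_mul_of_nonneg_left h4 hK
  linarith [hray k]

end Bounds

lemma norm_toR_max_sub_le {p : Rd d} (hp : 0 ≤ p.2) (w : Zd d) :
    ‖toR d ((w.1, max w.2 0) - w)‖ ≤ ‖p - toR d w‖ ∧
      ‖p - toR d (w.1, max w.2 0)‖ ≤ ‖p - toR d w‖ := by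
  have hfst : ‖p.1 - (toR d w).1‖ ≤ ‖p - toR d w‖ := norm_fst_le (p - toR d w)
  have hsnd : |p.2 - w.2| ≤ ‖p - toR d w‖ := norm_snd_le (p - toR d w)
  rcases le_total 0 w.2 with hw | hw
  · rw [max_eq_left hw]
    simp [toR_zero]
  · have hw' : (w.2 : ℝ) ≤ 0 := by exact_mod_cast hw
    rw [max_eq_right hw]
    rw [abs_of_nonneg (by linarith)] at hsnd
    constructor
    · have h0 : toR d ((w.1, 0) - w) = (0, -(w.2 : ℝ)) := by ext <;> simp [toR]
      rw [h0, Prod.norm_mk, norm_zero, norm_neg, Real.norm_eq_abs, abs_of_nonpos hw']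
      exact max_le (norm_nonneg _) (by linarith)
    · rw [Prod.norm_def]
      refine max_le hfst ?_
      have h0 : ‖(p - toR d (w.1, 0)).2‖ = p.2 := by simp [toR, abs_of_nonneg hp]
      linarith

lemma tendsto_mul_natFloor {ε : ℕ → ℝ} (hε : ∀ n, 0 < ε n) (hε0 : Tendsto ε atTop (nhds 0)) {s : ℝ}
    (hs : 0 ≤ s) : Tendsto (fun n => ε n * (⌊s * (ε n)⁻¹⌋₊ : ℝ)) atTop (nhds s) := by
  have hinv : Tendsto (fun n => (ε n)⁻¹) atTop atTop :=
    (tendsto_nhdsWithin_iff.2 ⟨hε0, Eventually.of_forall hε⟩).inv_tendsto_nhdsGT_zero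
  refine ((tendsto_nat_floor_mul_div_atTop hs).comp hinv).congr fun n => ?_
  simp [div_inv_eq_mul, mul_comm]

end Asymptotics

section Limits

variable {d : ℕ} {ν : Zd d → ℝ≥0∞} (hirr : AddSubmonoid.closure {u | ν u ≠ 0} = ⊤)
  {ε : ℕ → ℝ} {x : Zd d} {y : ℕ → Zd d} {q : Rd d}
  (hε : ∀ n, 0 < ε n) (hε0 : Tendsto ε atTop (nhds 0)) (hx : 0 < x.2) (hy : ∀ n, 0 < (y n).2)
  (hlim : Tendsto (fun n => ε n • toR d (y n)) atTop (nhds q))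

include hirr hε hε0 hx hy hlim

lemma eventually_mul_log_green_lt {a : Rd d} (ha : ∑' u, ν u * expChar a u < 1) {c : ℝ}
    (hc : -dotR d a q < c) :
    ∀ᶠ n in atTop, ε n * Real.log (∑' k, kerIter (halfKer ν) k x (y n)).toReal < c := by
  obtain ⟨C, hC⟩ := exists_log_green_le hirr ha hx
  have h1 : Tendsto (fun n => ε n * C - dotR d a (ε n • toR d (y n))) atTop
      (nhds (0 * C - dotR d a q)) :=
    (hε0.mul_const C).sub (((continuous_dotR a).tendsto q).comp hlim)
  rw [zero_mul, zero_sub] at h1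
  filter_upwards [h1.eventually (gt_mem_nhds hc)] with n hn
  refine lt_of_le_of_lt ?_ hn
  rw [dotR_smul, ← mul_sub]
  exact mul_le_mul_of_nonneg_left (hC (y n) (hy n)) (hε n).le

lemma eventually_lt_mul_log_green (hν : ∑' u, ν u = 1) (hq : 0 ≤ q.2)
    (htop : ∀ n, ∑' k, kerIter (halfKer ν) k x (y n) ≠ ⊤) {S c : ℝ}
    (hS : ∀ a, (∀ w, dotZ d a w ≤ freeCost ν w) → dotR d a q ≤ S) (hc : c < -S) :
    ∀ᶠ n in atTop, c < ε n * Real.log (∑' k, kerIter (halfKer ν) k x (y n)).toReal := by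
  obtain ⟨K, hK, hKle⟩ := exists_halfCost_le hν hirr
  obtain ⟨a, ha, hδ⟩ := exists_dual_vector (K := 2 * K) (by positivity) (freeCost_nonneg hν)
    (freeCost_zero hν) (freeCost_add_le hν hirr) q
  set δ : ℝ := (-S - c) / 4 with hδdef
  have hδpos : 0 < δ := by
    rw [hδdef]
    linarith
  obtain ⟨t, ht, w, hw⟩ := hδ δ hδpos
  obtain ⟨hw1, hw2⟩ := norm_toR_max_sub_le (p := t • q) (mul_nonneg ht.le hq) w
  set w' : Zd d := (w.1, max w.2 0) with hw'
  have hfree : freeCost ν w' ≤ freeCost ν w + K * ‖t • q - toR d w‖ := by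
    have h1 := freeCost_add_le hν hirr w (w' - w)
    rw [add_sub_cancel] at h1
    have h2 := freeCost_le_of_halfCost_le hν hirr hKle (w' - w)
    have h3 := mul_le_mul_of_nonneg_left hw1 hK
    linarith
  set η := t * δ
  have hη : 0 < η := by positivity
  obtain ⟨C, hC⟩ := exists_halfCost_le_nsmul hν hirr hK hKle (w := w') (le_max_right _ _) hη hx
  have hk := tendsto_mul_natFloor hε hε0 (inv_pos.2 ht).le
  set k : ℕ → ℕ := fun n => ⌊t⁻¹ * (ε n)⁻¹⌋₊
  set L := t⁻¹ * (freeCost ν w' + η) + K * ‖q - t⁻¹ • toR d w'‖ with hL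
  have h1 : Tendsto (fun n => ε n * C + (ε n * (k n : ℝ) * (freeCost ν w' + η)
      + K * ‖ε n • toR d (y n) - (ε n * (k n : ℝ)) • toR d w'‖)) atTop (nhds (0 * C + L)) :=
    (hε0.mul_const C).add ((hk.mul_const _).add
      ((hlim.sub (hk.smul_const (toR d w'))).norm.const_mul K))
  have hLlt : 0 * C + L < -c := by
    have h2 : t * L = freeCost ν w' + η + K * ‖t • q - toR d w'‖ := by
      have h3 : t • q - toR d w' = t • (q - t⁻¹ • toR d w') := by
        rw [smul_sub, smul_inv_smul₀ ht.ne']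
      rw [h3, norm_smul, Real.norm_of_nonneg ht.le, hL]
      field_simp
    have h4 := mul_le_mul_of_nonneg_left hw2 hK
    have h5 : t * L < t * (dotR d a q + 2 * δ) := by
      rw [h2]
      have h6 : t * (dotR d a q + 2 * δ) = t * (dotR d a q + δ) + η := by ring
      linarith
    have h7 := lt_of_mul_lt_mul_left h5 ht.le
    have h8 := hS a ha
    linarith
  filter_upwards [h1.eventually (gt_mem_nhds hLlt)] with n hn
  have h2 := mul_le_mul_of_nonneg_left (hC (k n) (y n) (hy n)) (hε n).le
  have h3 : ‖ε n • toR d (y n) - (ε n * (k n : ℝ)) • toR d w'‖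
      = ε n * ‖toR d (y n) - (k n : ℝ) • toR d w'‖ := by
    rw [mul_smul, ← smul_sub, norm_smul, Real.norm_of_nonneg (hε n).le]
  have h4 := mul_le_mul_of_nonneg_left
    (neg_halfCost_le_log_green hν hirr hx (hy n) (htop n)) (hε n).le
  rw [h3] at hn
  linarith

end Limits

/-- logarithmic asymptotics of the Green's function `G₊` of the
killed walk: `ε_n log G₊(z,z_n) → -sup_{a∈D} a·q`. -/
theorem log_asymptotics_green_plus
    (d : ℕ) (hd : 2 ≤ d) (μ μ0 : Zd d → ℝ)
    (hμ : IsProb d μ) (hμ0 : IsProb d μ0)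
    (hH2 : H2 d μ) (hH3 : H3 d μ μ0) (hH4 : H4 d μ μ0)
    (q : Rd d) (hq : 0 ≤ q.2)
    (z : St d) (hz : z.2 ≠ 0)
    (ε : ℕ → ℝ) (zn : ℕ → St d)
    (hε : ∀ n, 0 < ε n) (hzn : ∀ n, (zn n).2 ≠ 0)
    (hε0 : Tendsto ε atTop (nhds 0))
    (hlim : Tendsto (fun n => ε n • toR d (toZ d (zn n))) atTop (nhds q)) :
    Tendsto (fun n => ε n * Real.log ((greenPlus d μ μ0 z (zn n)).toReal))
      atTop (nhds (-(⨆ a : ↥(Dset d μ), dotR d (a : Rd d) q))) := by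
  have hexp := fun a => (hH4 a).1
  have hν := tsum_ofReal_eq_one hμ
  have hirr := closure_support_eq_top hH2.1
  have hx : 0 < (toZ d z).2 := Int.natCast_pos.2 (Nat.pos_of_ne_zero hz)
  have hy : ∀ n, 0 < (toZ d (zn n)).2 := fun n => Int.natCast_pos.2 (Nat.pos_of_ne_zero (hzn n))
  have hlt : ∀ {a : Rd d}, jgf d μ a < 1 → ∑' u, ENNReal.ofReal (μ u) * expChar a u < 1 := by
    intro a ha
    rwa [← ofReal_jgf hμ.1 (hexp a), ENNReal.ofReal_lt_one]
  simp only [greenPlus_eq_tsum_kerIter μ μ0 hz]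
  obtain ⟨a₀, ha₀⟩ := exists_jgf_lt_one hμ hexp hH3.1
  have hne : Nonempty (Dset d μ) := ⟨⟨a₀, ha₀.le⟩⟩
  refine tendsto_order.2 ⟨fun c hc => ?_, fun c hc => ?_⟩
  · refine eventually_lt_mul_log_green hirr hε hε0 hx hy hlim hν hq
      (fun n => tsum_kerIter_halfKer_ne_top (hlt ha₀) _ _) (fun a ha => ?_) hc
    obtain ⟨K, hK, hKle⟩ := exists_halfCost_le hν hirr
    have hbdd : BddAbove (Set.range fun a : ↥(Dset d μ) => dotR d (a : Rd d) q) := by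
      refine ⟨K * ((∑ i, |q.1 i|) + |q.2|), ?_⟩
      rintro _ ⟨⟨b, hb⟩, rfl⟩
      exact dotR_le_of_norm_le (norm_le_of_dotZ_le hK (freeCost_le_of_halfCost_le hν hirr hKle)
        (dotZ_le_freeCost hν hirr ((mem_Dset_iff hμ.1 hexp).1 hb))) q
    exact le_ciSup hbdd
      ⟨a, (mem_Dset_iff hμ.1 hexp).2 (tsum_mul_expChar_le_one_of_dotZ_le hν hirr ha)⟩
  · obtain ⟨⟨a, ha⟩, hac⟩ := exists_lt_of_lt_ciSup (neg_lt.1 hc)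
    obtain ⟨b, hb, hbc⟩ := exists_jgf_lt_one_of_lt_dotR hμ hexp hH3.1 ha hac
    exact eventually_mul_log_green_lt hirr hε hε0 hx hy hlim (hlt hb) (neg_lt.1 hbc)

end ReflectedRW
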